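/- arXiv:1110.6551 — 3 statements merged into one kernel-verified Lean document; each statement's English description precedes it below -/
import Mathlib

section
/- Let c : I → ℝ² be a smooth non-degenerate plane curve parametrized by affine arclength, with affine curvature κ, and fix p ∈ I. Then the gravity curve γ_p of c at p is flat if and only if κ'(p) = 0. -/
open Set

noncomputable section

/-- The determinant `det(u,v) = u₁v₂ − u₂v₁` of two vectors of `ℝ²`. -/
def det2 (u v : ℝ × ℝ) : ℝ := u.1 * v.2 - u.2 * v.1

/-- `IsGravityCurve c I p ε γ`: `γ` is the gravity curve of the curve `c` (defined
on `I`) at `p`, on the parameter range `[0, ε)`.  This encodes: `γ 0 = c p`, and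
there are a neighborhood `J ⊆ I` of `p` and functions `s₋, s₊` such that for every
`δ ∈ (0, ε)` the translated tangent line `ℓ_δ = {c p + δ·c''(p) + t·c'(p)}` meets
`c(J)` exactly in the two points `c (s₋ δ)`, `c (s₊ δ)` with `s₋ δ < p < s₊ δ`,
and `γ δ` is the midpoint of these two points. -/
def IsGravityCurve (c : ℝ → ℝ × ℝ) (I : Set ℝ) (p : ℝ) (ε : ℝ) (γ : ℝ → ℝ × ℝ) :
    Prop :=
  0 < ε ∧ γ 0 = c p ∧
  ∃ J : Set ℝ, J ⊆ I ∧ IsOpen J ∧ p ∈ J ∧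
    ∃ sm sp : ℝ → ℝ, ∀ δ ∈ Set.Ioo 0 ε,
      sm δ ∈ J ∧ sp δ ∈ J ∧ sm δ < p ∧ p < sp δ ∧
      (∀ s ∈ J,
        (det2 (c s - (c p + δ • iteratedDeriv 2 c p)) (iteratedDeriv 1 c p) = 0 ↔
          s = sm δ ∨ s = sp δ)) ∧
      γ δ = (2⁻¹ : ℝ) • (c (sm δ) + c (sp δ))

/-- The gravity curve `γ` (with parameter range `[0, ε)`) is a straight line:
locally near `δ = 0` its image is contained in an affine line of `ℝ²`. -/
def IsStraightLine (γ : ℝ → ℝ × ℝ) (ε : ℝ) : Prop :=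
  ∃ ε₀ : ℝ, 0 < ε₀ ∧ ε₀ ≤ ε ∧ ∃ x v : ℝ × ℝ, v ≠ 0 ∧
    ∀ δ ∈ Set.Ico (0 : ℝ) ε₀, ∃ t : ℝ, γ δ = x + t • v


open Filter Topology Asymptotics

theorem isLittleO_of_hasDerivAt {f f' : ℝ → ℝ} {p : ℝ} {n : ℕ}
    (hf : ∀ᶠ s in 𝓝 p, HasDerivAt f (f' s) s) (hp : f p = 0)
    (h : f' =o[𝓝 p] fun s => (s - p) ^ n) : f =o[𝓝 p] fun s => (s - p) ^ (n + 1) := by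
  rw [isLittleO_iff] at h ⊢
  intro C hC
  obtain ⟨r, hr, hball⟩ := Metric.eventually_nhds_iff_ball.1 (hf.and (h hC))
  filter_upwards [Metric.ball_mem_nhds p hr] with s hs
  have hsub : Metric.closedBall p (dist s p) ⊆ Metric.ball p r :=
    Metric.closedBall_subset_ball hs
  have key := Convex.norm_image_sub_le_of_norm_hasDerivWithin_le (f := f) (f' := f')
    (s := Metric.closedBall p (dist s p)) (C := C * ‖(s - p) ^ n‖) (x := p) (y := s)
    (fun u hu => (hball u (hsub hu)).1.hasDerivWithinAt)
    (fun u hu => (hball u (hsub hu)).2.trans ?_) (convex_closedBall _ _)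
    (Metric.mem_closedBall_self dist_nonneg) (Metric.mem_closedBall.2 le_rfl)
  · rw [hp, sub_zero] at key
    rw [pow_succ, norm_mul, ← mul_assoc]
    exact key
  · rw [norm_pow, norm_pow]
    have : ‖u - p‖ ≤ ‖s - p‖ := by
      rw [← dist_eq_norm, ← dist_eq_norm]; exact hu
    gcongr

/-- Taylor expansions at `p` of a solution of `g'' = -κ g`, `g p = 0`, `g' p = 1`, and of its
primitive vanishing at `p`. -/
theorem taylor_of_affine_ode {h g g1 κ : ℝ → ℝ} {p k : ℝ}
    (hh : ∀ᶠ s in 𝓝 p, HasDerivAt h (g s) s) (hg : ∀ᶠ s in 𝓝 p, HasDerivAt g (g1 s) s)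
    (hg1 : ∀ᶠ s in 𝓝 p, HasDerivAt g1 (-κ s * g s) s) (hκ : HasDerivAt κ k p)
    (h0 : h p = 0) (g0 : g p = 0) (g10 : g1 p = 1) :
    ((fun s => g s - (s - p) + κ p / 6 * (s - p) ^ 3 + k / 12 * (s - p) ^ 4)
      =o[𝓝 p] fun s => (s - p) ^ 4) ∧
    ((fun s => h s - (s - p) ^ 2 / 2 + κ p / 24 * (s - p) ^ 4 + k / 60 * (s - p) ^ 5)
      =o[𝓝 p] fun s => (s - p) ^ 5) := by
  have hid : ∀ s : ℝ, HasDerivAt (fun s => s - p) 1 s := fun s => (hasDerivAt_id s).sub_const p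
  have e1 : (fun s => g1 s - 1) =o[𝓝 p] fun s => (s - p) ^ 1 := by
    have := hasDerivAt_iff_isLittleO.1 hg1.self_of_nhds
    simpa [g0, g10] using this
  have e2 : (fun s => g s - (s - p)) =o[𝓝 p] fun s => (s - p) ^ 2 := by
    refine isLittleO_of_hasDerivAt ?_ (by simp [g0]) e1
    filter_upwards [hg] with s hs using hs.sub (hid s)
  have e3 : (fun s => -κ s * g s + κ p * (s - p) + k * (s - p) ^ 2)
      =o[𝓝 p] fun s => (s - p) ^ 2 := by
    have a : (fun s => -κ s * (g s - (s - p))) =o[𝓝 p] fun s => (1 : ℝ) * (s - p) ^ 2 :=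
      (hκ.continuousAt.neg.isBigO_one ℝ).mul_isLittleO e2
    have b : (fun s => (κ s - κ p - (s - p) • k) * (s - p)) =o[𝓝 p]
        fun s => (s - p) * (s - p) :=
      (hasDerivAt_iff_isLittleO.1 hκ).mul_isBigO (isBigO_refl _ _)
    simp only [one_mul, ← pow_two] at a b
    refine (a.sub b).congr_left fun s => ?_
    simp only [smul_eq_mul]; ring
  have e4 : (fun s => g1 s - 1 + κ p / 2 * (s - p) ^ 2 + k / 3 * (s - p) ^ 3)
      =o[𝓝 p] fun s => (s - p) ^ 3 := by
    refine isLittleO_of_hasDerivAt ?_ (by simp [g10]) e3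
    filter_upwards [hg1] with s hs
    refine (((hs.sub_const 1).add (((hid s).pow 2).const_mul (κ p / 2))).add
      (((hid s).pow 3).const_mul (k / 3))).congr_deriv ?_
    push_cast; ring
  have e5 : (fun s => g s - (s - p) + κ p / 6 * (s - p) ^ 3 + k / 12 * (s - p) ^ 4)
      =o[𝓝 p] fun s => (s - p) ^ 4 := by
    refine isLittleO_of_hasDerivAt ?_ (by simp [g0]) e4
    filter_upwards [hg] with s hs
    refine (((hs.sub (hid s)).add (((hid s).pow 3).const_mul (κ p / 6))).add
      (((hid s).pow 4).const_mul (k / 12))).congr_deriv ?_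
    push_cast; ring
  refine ⟨e5, isLittleO_of_hasDerivAt ?_ (by simp [h0]) e5⟩
  filter_upwards [hh] with s hs
  refine (((hs.sub (((hid s).pow 2).div_const 2)).add
    (((hid s).pow 4).const_mul (κ p / 24))).add
      (((hid s).pow 5).const_mul (k / 60))).congr_deriv ?_
  push_cast; ring

/-- The signed square root of `2h`, of the sign of `s - p`. -/
def signedSqrt (h : ℝ → ℝ) (p s : ℝ) : ℝ := (s - p) * √(2 * h s / (s - p) ^ 2)

theorem signedSqrt_of_lt {h : ℝ → ℝ} {p s : ℝ} (hs : p < s) :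
    signedSqrt h p s = √(2 * h s) := by
  have : 0 < s - p := sub_pos.2 hs
  rw [signedSqrt, Real.sqrt_div' _ (sq_nonneg _), Real.sqrt_sq this.le]
  field_simp

theorem signedSqrt_of_gt {h : ℝ → ℝ} {p s : ℝ} (hs : s < p) :
    signedSqrt h p s = -√(2 * h s) := by
  have : s - p < 0 := sub_neg.2 hs
  rw [signedSqrt, Real.sqrt_div' _ (sq_nonneg _), Real.sqrt_sq_eq_abs, abs_of_neg this, div_neg,
    mul_neg, mul_div_cancel₀ _ this.ne]

theorem inv_cube_sub_inv_cube {t a A B n m y z : ℝ} (ht : t ≠ 0) (hy0 : y ≠ 0) (hz0 : z ≠ 0)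
    (hA : A = -a / 24 + t * n) (hB : B = -a / 6 + t * m)
    (hy : y = 1 + t ^ 2 * A) (hz : z = 1 + t ^ 2 * B) :
    (3 * (n - m) + t * (3 * (A ^ 2 - B ^ 2) + t ^ 2 * (A ^ 3 - B ^ 3) -
      3 * a / 8 * (A * (y + 1) * z ^ 3 + B * (z ^ 2 + z + 1)))) / (z ^ 3 * y ^ 3) =
    ((t * z) ^ 3)⁻¹ - ((t * y) ^ 3)⁻¹ - 3 * a / 8 * (t * y)⁻¹ := by
  have e1 : y ^ 2 * z ^ 3 = 1 + t ^ 2 * (A * (y + 1) * z ^ 3 + B * (z ^ 2 + z + 1)) := by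
    linear_combination (y + 1) * z ^ 3 * hy + (z ^ 2 + z + 1) * hz
  have e2 : y ^ 3 - z ^ 3 = (1 + t ^ 2 * A) ^ 3 - (1 + t ^ 2 * B) ^ 3 := by rw [← hy, ← hz]
  have e3 : t * (n - m) = A - B - a / 8 := by rw [hA, hB]; ring
  generalize A * (y + 1) * z ^ 3 + B * (z ^ 2 + z + 1) = Q at *
  have e4 : ((t * z) ^ 3)⁻¹ - ((t * y) ^ 3)⁻¹ - 3 * a / 8 * (t * y)⁻¹ =
      (y ^ 3 - z ^ 3 - 3 * a / 8 * t ^ 2 * (y ^ 2 * z ^ 3)) / (t ^ 3 * (z ^ 3 * y ^ 3)) := by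
    field_simp
  rw [e4, e1, e2, div_eq_div_iff (by positivity) (by positivity)]
  linear_combination (3 * t ^ 2 * z ^ 3 * y ^ 3) * e3

/-- Modulo odd powers of the signed square root of `2h`, the functions `1 / g` and `1 / g ^ 3`
converge at `p` to `0` and to `κ'(p) / 5`. -/
theorem tendsto_inv_sub_signedSqrt {h g κ : ℝ → ℝ} {p k : ℝ}
    (hg : (fun s => g s - (s - p) + κ p / 6 * (s - p) ^ 3 + k / 12 * (s - p) ^ 4)
      =o[𝓝 p] fun s => (s - p) ^ 4)
    (hh : (fun s => h s - (s - p) ^ 2 / 2 + κ p / 24 * (s - p) ^ 4 + k / 60 * (s - p) ^ 5)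
      =o[𝓝 p] fun s => (s - p) ^ 5) :
    (∀ᶠ s in 𝓝[≠] p, 0 < h s ∧ g s ≠ 0) ∧
    Tendsto (fun s => (g s)⁻¹ - (signedSqrt h p s)⁻¹) (𝓝[≠] p) (𝓝 0) ∧
    Tendsto (fun s => (g s ^ 3)⁻¹ - (signedSqrt h p s ^ 3)⁻¹ -
      3 * κ p / 8 * (signedSqrt h p s)⁻¹) (𝓝[≠] p) (𝓝 (k / 5)) := by
  set m : ℝ → ℝ := fun s => (g s - (s - p) + κ p / 6 * (s - p) ^ 3) / (s - p) ^ 4 with hm_def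
  set q : ℝ → ℝ := fun s => (2 * h s - (s - p) ^ 2 + κ p / 12 * (s - p) ^ 4) / (s - p) ^ 5
    with hq_def
  have hne : ∀ᶠ s in 𝓝[≠] p, s - p ≠ 0 := by
    filter_upwards [self_mem_nhdsWithin] with s hs using sub_ne_zero.2 hs
  have ht : Tendsto (fun s => s - p) (𝓝[≠] p) (𝓝 0) :=
    ((continuous_id.sub continuous_const).tendsto' p 0 (by simp)).mono_left nhdsWithin_le_nhds
  have hm : Tendsto m (𝓝[≠] p) (𝓝 (-k / 12)) := by
    have := ((hg.mono nhdsWithin_le_nhds).tendsto_div_nhds_zero (l := 𝓝[≠] p)).sub_const (k / 12)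
    refine (this.congr' ?_).trans (by rw [zero_sub, neg_div])
    filter_upwards [hne] with s hs
    simp only [hm_def]; field_simp; ring
  have hq : Tendsto q (𝓝[≠] p) (𝓝 (-k / 30)) := by
    have := (((hh.mono nhdsWithin_le_nhds).tendsto_div_nhds_zero (l := 𝓝[≠] p)).const_mul
      2).sub_const (k / 30)
    refine (this.congr' ?_).trans (by rw [mul_zero, zero_sub, neg_div])
    filter_upwards [hne] with s hs
    simp only [hq_def]; field_simp; ring
  set z : ℝ → ℝ := fun s => g s / (s - p) with hz_def
  set y : ℝ → ℝ := fun s => √(2 * h s / (s - p) ^ 2) with hy_def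
  set B : ℝ → ℝ := fun s => -κ p / 6 + (s - p) * m s with hB_def
  set C : ℝ → ℝ := fun s => -κ p / 12 + (s - p) * q s with hC_def
  have hB : Tendsto B (𝓝[≠] p) (𝓝 (-κ p / 6)) := by
    simpa using (ht.mul hm).const_add (-κ p / 6)
  have hC : Tendsto C (𝓝[≠] p) (𝓝 (-κ p / 12)) := by
    simpa using (ht.mul hq).const_add (-κ p / 12)
  have hzB : ∀ᶠ s in 𝓝[≠] p, z s = 1 + (s - p) ^ 2 * B s := by
    filter_upwards [hne] with s hs
    simp only [hz_def, hB_def, hm_def]; field_simp; ring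
  have hyC : ∀ᶠ s in 𝓝[≠] p, 2 * h s / (s - p) ^ 2 = 1 + (s - p) ^ 2 * C s := by
    filter_upwards [hne] with s hs
    simp only [hC_def, hq_def]; field_simp; ring
  have hz : Tendsto z (𝓝[≠] p) (𝓝 1) := by
    have : Tendsto (fun s => 1 + (s - p) ^ 2 * B s) (𝓝[≠] p) (𝓝 1) := by
      simpa using ((ht.pow 2).mul hB).const_add 1
    exact this.congr' (hzB.mono fun s hs => hs.symm)
  have hy2 : Tendsto (fun s => 2 * h s / (s - p) ^ 2) (𝓝[≠] p) (𝓝 1) := by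
    have : Tendsto (fun s => 1 + (s - p) ^ 2 * C s) (𝓝[≠] p) (𝓝 1) := by
      simpa using ((ht.pow 2).mul hC).const_add 1
    exact this.congr' (hyC.mono fun s hs => hs.symm)
  have hy : Tendsto y (𝓝[≠] p) (𝓝 1) := by simpa using hy2.sqrt
  have hypos : ∀ᶠ s in 𝓝[≠] p, 0 < y s := hy.eventually (lt_mem_nhds one_pos)
  have hzpos : ∀ᶠ s in 𝓝[≠] p, 0 < z s := hz.eventually (lt_mem_nhds one_pos)
  set n : ℝ → ℝ := fun s => q s / (y s + 1) + κ p / 24 * ((s - p) * C s) / (y s + 1) ^ 2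
    with hn_def
  set A : ℝ → ℝ := fun s => -κ p / 24 + (s - p) * n s with hA_def
  have hn : Tendsto n (𝓝[≠] p) (𝓝 (-k / 60)) := by
    have h1 := hq.div (hy.add_const 1) (by norm_num)
    have h2 := ((ht.mul hC).const_mul (κ p / 24)).div ((hy.add_const 1).pow 2)
      (by norm_num)
    refine (h1.add h2).trans (le_of_eq ?_)
    congr 1; ring
  have hA : Tendsto A (𝓝[≠] p) (𝓝 (-κ p / 24)) := by
    simpa using (ht.mul hn).const_add (-κ p / 24)
  have hyA : ∀ᶠ s in 𝓝[≠] p, y s = 1 + (s - p) ^ 2 * A s := by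
    filter_upwards [hne, hypos, hyC] with s hs hpos hsC
    have hsq : y s ^ 2 = 1 + (s - p) ^ 2 * C s := by
      rw [← hsC]; exact Real.sq_sqrt (Real.sqrt_pos.1 hpos).le
    have hq' : (s - p) * q s = C s + κ p / 12 := by simp only [hC_def]; ring
    have hA' : A s = C s / (y s + 1) := by
      have : A s = -κ p / 24 + ((s - p) * q s / (y s + 1) +
          κ p / 24 * ((s - p) ^ 2 * C s) / (y s + 1) ^ 2) := by
        simp only [hA_def, hn_def]; ring
      rw [this, hq', show (s - p) ^ 2 * C s = y s ^ 2 - 1 by rw [hsq]; ring]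
      field_simp; ring
    rw [hA', ← mul_div_assoc, show (s - p) ^ 2 * C s = y s ^ 2 - 1 by rw [hsq]; ring]
    field_simp; ring
  refine ⟨?_, ?_, ?_⟩
  · filter_upwards [hne, hypos, hzpos] with s hs h1 h2
    constructor
    · have h3 := Real.sqrt_pos.1 h1
      have h4 : 0 < (s - p) ^ 2 := by positivity
      have := (div_pos_iff_of_pos_right h4).1 h3
      linarith
    · rintro h0; simp [hz_def, h0] at h2
  · have : Tendsto (fun s => (s - p) * (A s - B s) / (z s * y s)) (𝓝[≠] p) (𝓝 0) := by
      simpa [Pi.div_def] using (ht.mul (hA.sub hB)).div (hz.mul hy) (by norm_num)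
    refine this.congr' ?_
    filter_upwards [hne, hypos, hzpos, hyA, hzB] with s hs h1 h2 h3 h4
    have hgz : g s = (s - p) * z s := by simp only [hz_def]; field_simp
    have hw : signedSqrt h p s = (s - p) * y s := rfl
    rw [hgz, hw]
    have : A s - B s = (y s - z s) / (s - p) ^ 2 := by
      rw [h3, h4]; field_simp; ring
    rw [this]; field_simp
  · set P : ℝ → ℝ := fun s => 3 * (n s - m s) + (s - p) * (3 * (A s ^ 2 - B s ^ 2) +
      (s - p) ^ 2 * (A s ^ 3 - B s ^ 3) -
      3 * κ p / 8 * (A s * (y s + 1) * z s ^ 3 + B s * (z s ^ 2 + z s + 1))) with hP_def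
    have hP : Tendsto P (𝓝[≠] p) (𝓝 (k / 5)) := by
      have h1 := (hn.sub hm).const_mul 3
      have h2 := ((((hA.pow 2).sub (hB.pow 2)).const_mul 3).add
        ((ht.pow 2).mul ((hA.pow 3).sub (hB.pow 3)))).sub
        ((((hA.mul (hy.add_const 1)).mul (hz.pow 3)).add
          (hB.mul (((hz.pow 2).add hz).add_const 1))).const_mul (3 * κ p / 8))
      refine (h1.add (ht.mul h2)).trans (le_of_eq ?_)
      congr 1; ring
    have : Tendsto (fun s => P s / (z s ^ 3 * y s ^ 3)) (𝓝[≠] p) (𝓝 (k / 5)) := by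
      simpa [Pi.div_def] using hP.div ((hz.pow 3).mul (hy.pow 3)) (by norm_num)
    refine this.congr' ?_
    filter_upwards [hne, hypos, hzpos, hyA, hzB] with s hs h1 h2 h3 h4
    have hgz : g s = (s - p) * z s := by simp only [hz_def]; field_simp
    have hw : signedSqrt h p s = (s - p) * y s := rfl
    rw [hgz, hw]
    exact inv_cube_sub_inv_cube hs h1.ne' h2.ne' rfl rfl h3 h4
/-- An inverse branch of `h` on `U` is differentiable. -/
theorem hasDerivAt_inverse_branch {h σ : ℝ → ℝ} {U : Set ℝ} {ε δ g : ℝ} (hU : IsOpen U)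
    (hσU : ∀ δ ∈ Ioo 0 ε, σ δ ∈ U) (hσ : ∀ δ ∈ Ioo 0 ε, ∀ s ∈ U, h s = δ ↔ s = σ δ)
    (hδ : δ ∈ Ioo 0 ε) (hh : HasStrictDerivAt h g (σ δ)) (hg : g ≠ 0) :
    HasDerivAt σ g⁻¹ δ := by
  have hval : h (σ δ) = δ := (hσ δ hδ _ (hσU δ hδ)).2 rfl
  have hleft : ∀ᶠ s in 𝓝 (σ δ), σ (h s) = s := by
    have h1 : ∀ᶠ s in 𝓝 (σ δ), h s ∈ Ioo 0 ε :=
      hh.hasDerivAt.continuousAt.eventually (hval.symm ▸ isOpen_Ioo.mem_nhds hδ)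
    filter_upwards [h1, hU.mem_nhds (hσU δ hδ)] with s hs hsU
    exact ((hσ _ hs s hsU).1 rfl).symm
  simpa [hval] using (hh.to_local_left_inverse hg hleft).hasDerivAt

/-- An inverse branch of `h` on a one-sided neighbourhood `U` of a strict zero `p` of `h`
converges to `p`. -/
theorem tendsto_inverse_branch {h σ : ℝ → ℝ} {U : Set ℝ} {ε p : ℝ} (hε : 0 < ε)
    (hσU : ∀ δ ∈ Ioo 0 ε, σ δ ∈ U) (hσ : ∀ δ ∈ Ioo 0 ε, ∀ s ∈ U, h s = δ ↔ s = σ δ)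
    (hpU : p ∉ U) (hU : ∀ r > 0, ∃ q, q ≠ p ∧ uIcc p q ⊆ Metric.ball p r ∧ uIcc p q ⊆ insert p U)
    (hc : ∀ᶠ s in 𝓝 p, ContinuousAt h s) (h0 : h p = 0) (hpos : ∀ᶠ s in 𝓝[≠] p, 0 < h s) :
    Tendsto σ (𝓝[>] 0) (𝓝[≠] p) := by
  have hsmall : ∀ᶠ δ in 𝓝[>] (0 : ℝ), δ ∈ Ioo 0 ε := Ioo_mem_nhdsGT hε
  refine tendsto_nhdsWithin_iff.2 ⟨?_, ?_⟩
  · rw [Metric.nhds_basis_ball.tendsto_right_iff]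
    intro r hr
    obtain ⟨r', hr', hball⟩ := Metric.eventually_nhds_iff_ball.1
      (hc.and (eventually_nhdsWithin_iff.1 hpos))
    obtain ⟨q, hqp, hq1, hq2⟩ := hU (min r r') (lt_min hr hr')
    have hq1' : uIcc p q ⊆ Metric.ball p r' :=
      hq1.trans (Metric.ball_subset_ball (min_le_right _ _))
    have hhq : 0 < h q := (hball q (hq1' right_mem_uIcc)).2 hqp
    filter_upwards [hsmall, Ioo_mem_nhdsGT hhq] with δ hδ hδq
    have hcont : ContinuousOn h (uIcc p q) := fun s hs =>
      (hball s (hq1' hs)).1.continuousWithinAt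
    obtain ⟨s, hs, hsδ⟩ := intermediate_value_uIcc hcont
      (Icc_subset_uIcc (show δ ∈ Icc (h p) (h q) from ⟨h0.symm ▸ hδ.1.le, hδq.2.le⟩))
    have hsU : s ∈ U := by
      rcases hq2 hs with rfl | h'
      · rw [h0] at hsδ; exact absurd hsδ hδ.1.ne
      · exact h'
    rw [← (hσ δ hδ s hsU).1 hsδ]
    exact Metric.ball_subset_ball (min_le_left _ _) (hq1 hs)
  · filter_upwards [hsmall] with δ hδ h'
    exact hpU (h' ▸ hσU δ hδ)

theorem hasDerivAt_det2_left {f : ℝ → ℝ × ℝ} {f' : ℝ × ℝ} {s : ℝ} (hf : HasDerivAt f f' s)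
    (v : ℝ × ℝ) : HasDerivAt (fun s => det2 (f s) v) (det2 f' v) s := by
  have h1 : HasDerivAt (fun s => (f s).1) f'.1 s := 
    (hasFDerivAt_fst.comp_hasDerivAt s hf :)
  have h2 : HasDerivAt (fun s => (f s).2) f'.2 s := 
    (hasFDerivAt_snd.comp_hasDerivAt s hf :)
  exact (h1.mul_const v.2).sub (h2.mul_const v.1)

theorem hasDerivAt_iteratedDeriv {E : Type*} [NormedAddCommGroup E] [NormedSpace ℝ E]
    {I : Set ℝ} (hI : IsOpen I) {c : ℝ → E} (hc : ContDiffOn ℝ (⊤ : ℕ∞) c I)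
    (n : ℕ) {s : ℝ} (hs : s ∈ I) :
    HasDerivAt (iteratedDeriv n c) (iteratedDeriv (n + 1) c s) s := by
  have hn : ContDiffOn ℝ (⊤ : ℕ∞) (iteratedDeriv n c) I := by
    induction n with
    | zero => simpa using hc
    | succ n ih =>
      rw [iteratedDeriv_succ]
      exact ih.deriv_of_isOpen hI (by simp)
  rw [iteratedDeriv_succ]
  exact (((hn s hs).contDiffAt (hI.mem_nhds hs)).differentiableAt (by simp)).hasDerivAt

/-- The affine curvature is recovered from the curve as `det(c'', c''')`. -/
theorem differentiableAt_affineCurvature {I : Set ℝ} (hI : IsOpen I) {c : ℝ → ℝ × ℝ}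
    (hc : ContDiffOn ℝ (⊤ : ℕ∞) c I)
    (hdet : ∀ s ∈ I, det2 (iteratedDeriv 1 c s) (iteratedDeriv 2 c s) = 1) {κ : ℝ → ℝ}
    (hκ : ∀ s ∈ I, iteratedDeriv 3 c s = -κ s • iteratedDeriv 1 c s) {p : ℝ} (hp : p ∈ I) :
    DifferentiableAt ℝ κ p := by
  have h2 := (hasDerivAt_iteratedDeriv hI hc 2 hp).differentiableAt
  have h3 := (hasDerivAt_iteratedDeriv hI hc 3 hp).differentiableAt
  have : DifferentiableAt ℝ (fun s => det2 (iteratedDeriv 2 c s) (iteratedDeriv 3 c s)) p := by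
    unfold det2
    exact (h2.fst.mul h3.snd).sub (h2.snd.mul h3.fst)
  refine this.congr_of_eventuallyEq ?_
  filter_upwards [hI.mem_nhds hp] with s hs
  have := hdet s hs
  rw [hκ s hs]
  simp only [det2, Prod.smul_fst, Prod.smul_snd, smul_eq_mul] at this ⊢
  linear_combination (-κ s) * this

/-- For two inverse branches `σ₁`, `σ₂` of `h` on either side of `p`, the average of `x ∘ σ₁` and
`x ∘ σ₂` is twice differentiable from the right at `0`, with first derivative `0` and second
derivative `-k / 5`. -/
theorem exists_deriv_average_branches {h g g1 κ x x1 x2 σ₁ σ₂ : ℝ → ℝ} {p k : ℝ}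
    (hh : ∀ᶠ s in 𝓝 p, HasDerivAt h (g s) s) (hg : ∀ᶠ s in 𝓝 p, HasDerivAt g (g1 s) s)
    (hg1 : ∀ᶠ s in 𝓝 p, HasDerivAt g1 (-κ s * g s) s) (hκ : HasDerivAt κ k p)
    (h0 : h p = 0) (g0 : g p = 0) (g10 : g1 p = 1)
    (hx : ∀ᶠ s in 𝓝 p, HasDerivAt x (x1 s) s) (hx1 : ∀ᶠ s in 𝓝 p, HasDerivAt x1 (x2 s) s)
    (x0 : x p = 0) (x10 : x1 p = 1) (x20 : x2 p = 0)
    (hwr : ∀ᶠ s in 𝓝 p, x2 s * g s - x1 s * g1 s = -1)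
    (hσ₁ : Tendsto σ₁ (𝓝[>] 0) (𝓝[≠] p)) (hσ₂ : Tendsto σ₂ (𝓝[>] 0) (𝓝[≠] p))
    (hlt : ∀ᶠ δ in 𝓝[>] 0, σ₁ δ < p) (hgt : ∀ᶠ δ in 𝓝[>] 0, p < σ₂ δ)
    (hh₁ : ∀ᶠ δ in 𝓝[>] 0, h (σ₁ δ) = δ) (hh₂ : ∀ᶠ δ in 𝓝[>] 0, h (σ₂ δ) = δ)
    (hd₁ : ∀ᶠ δ in 𝓝[>] 0, g (σ₁ δ) ≠ 0 → HasDerivAt σ₁ (g (σ₁ δ))⁻¹ δ)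
    (hd₂ : ∀ᶠ δ in 𝓝[>] 0, g (σ₂ δ) ≠ 0 → HasDerivAt σ₂ (g (σ₂ δ))⁻¹ δ)
    {X : ℝ → ℝ} (hX0 : X 0 = 0) (hX : ∀ᶠ δ in 𝓝[>] 0, X δ = (x (σ₁ δ) + x (σ₂ δ)) / 2) :
    ∃ D : ℝ → ℝ, D 0 = 0 ∧ (∀ᶠ δ in 𝓝[≥] 0, HasDerivWithinAt X (D δ) (Ici 0) δ) ∧
      HasDerivWithinAt D (-k / 5) (Ici 0) 0 := by
  obtain ⟨hgT, hhT⟩ := taylor_of_affine_ode hh hg hg1 hκ h0 g0 g10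
  obtain ⟨hne, hlim1, hlim3⟩ := tendsto_inv_sub_signedSqrt hgT hhT
  have hXR : ∀ᶠ s in 𝓝[≠] p, HasDerivAt x (x1 s) s ∧
      HasDerivAt (fun s => x1 s / g s) (-(g s ^ 2)⁻¹) s ∧ g s ≠ 0 := by
    filter_upwards [hne, hx.filter_mono nhdsWithin_le_nhds, hx1.filter_mono nhdsWithin_le_nhds,
      hg.filter_mono nhdsWithin_le_nhds, hwr.filter_mono nhdsWithin_le_nhds] with s h1 h2 h3 h4 h5
    refine ⟨h2, (h3.div h4 h1.2).congr_deriv ?_, h1.2⟩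
    rw [h5]; field_simp
  set D : ℝ → ℝ := fun δ => if δ = 0 then 0 else
    (x1 (σ₁ δ) / g (σ₁ δ) + x1 (σ₂ δ) / g (σ₂ δ)) / 2 with hD_def
  have hDne : ∀ {δ : ℝ}, 0 < δ → D δ = (x1 (σ₁ δ) / g (σ₁ δ) + x1 (σ₂ δ) / g (σ₂ δ)) / 2 :=
    fun hδ => by simp [hD_def, hδ.ne']
  have hD0 : D 0 = 0 := by simp [hD_def]
  have ev : ∀ {P : ℝ → Prop}, (∀ᶠ δ in 𝓝[>] (0 : ℝ), P δ) →
      ∀ᶠ δ in 𝓝[>] (0 : ℝ), ∀ᶠ δ' in 𝓝 δ, P δ' := fun hP => by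
    filter_upwards [eventually_eventually_nhdsWithin.2 hP, self_mem_nhdsWithin] with δ h1 h2
    rwa [isOpen_Ioi.nhdsWithin_eq h2] at h1
  -- derivatives for positive `δ`
  have hXd : ∀ᶠ δ in 𝓝[>] 0, HasDerivAt X (D δ) δ := by
    filter_upwards [hσ₁.eventually hXR, hσ₂.eventually hXR, hd₁, hd₂, ev hX, self_mem_nhdsWithin]
      with δ a1 a2 b1 b2 c1 hδ
    have := ((a1.1.comp δ (b1 a1.2.2)).add (a2.1.comp δ (b2 a2.2.2))).div_const 2
    refine (this.congr_of_eventuallyEq c1).congr_deriv ?_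
    rw [hDne hδ, div_eq_mul_inv (x1 _), div_eq_mul_inv (x1 _)]
  have hDd : ∀ᶠ δ in 𝓝[>] 0,
      HasDerivAt D (-((g (σ₁ δ) ^ 3)⁻¹ + (g (σ₂ δ) ^ 3)⁻¹) / 2) δ := by
    filter_upwards [hσ₁.eventually hXR, hσ₂.eventually hXR, hd₁, hd₂,
      ev self_mem_nhdsWithin] with δ a1 a2 b1 b2 hδ
    have := ((a1.2.1.comp δ (b1 a1.2.2)).add (a2.2.1.comp δ (b2 a2.2.2))).div_const 2
    refine (this.congr_of_eventuallyEq (hδ.mono fun _ h => hDne h)).congr_deriv ?_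
    have n1 := a1.2.2
    have n2 := a2.2.2
    field_simp
    ring
  have hw : ∀ᶠ δ in 𝓝[>] 0, signedSqrt h p (σ₁ δ) = -signedSqrt h p (σ₂ δ) := by
    filter_upwards [hlt, hgt, hh₁, hh₂] with δ h1 h2 h3 h4
    rw [signedSqrt_of_gt h1, signedSqrt_of_lt h2, h3, h4]
  -- limits at `0`
  have hXlim : Tendsto X (𝓝[>] 0) (𝓝 0) := by
    have hxc : Tendsto x (𝓝[≠] p) (𝓝 0) := by
      have := hx.self_of_nhds.continuousAt.tendsto
      rw [x0] at this
      exact this.mono_left nhdsWithin_le_nhds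
    have := ((hxc.comp hσ₁).add (hxc.comp hσ₂)).div_const 2
    simp only [add_zero, zero_div] at this
    exact this.congr' (hX.mono fun δ h => h.symm)
  have hDlim : Tendsto D (𝓝[>] 0) (𝓝 0) := by
    have hq : Tendsto (fun s => (x1 s - 1) / g s) (𝓝[≠] p) (𝓝 0) := by
      have s1 := hasDerivAt_iff_tendsto_slope.1 hx1.self_of_nhds
      have s2 := hasDerivAt_iff_tendsto_slope.1 hg.self_of_nhds
      have := s1.div s2 (by rw [g10]; norm_num)
      rw [x20, zero_div] at this
      refine this.congr' ?_
      filter_upwards [self_mem_nhdsWithin, hne] with s hs hs'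
      have := sub_ne_zero.2 hs
      have := hs'.2
      simp only [Pi.div_apply, slope_def_field, x10, g0]
      field_simp
      simp
    have hR : Tendsto (fun s => x1 s / g s - (signedSqrt h p s)⁻¹) (𝓝[≠] p) (𝓝 0) := by
      have := hq.add hlim1
      rw [add_zero] at this
      refine this.congr fun s => ?_
      ring
    have := ((hR.comp hσ₁).add (hR.comp hσ₂)).div_const 2
    simp only [add_zero, zero_div] at this
    refine this.congr' ?_
    filter_upwards [hw, self_mem_nhdsWithin] with δ h1 h2
    rw [hDne h2]
    simp only [Function.comp_apply, h1, inv_neg]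
    ring
  have hD'lim : Tendsto (fun δ => -((g (σ₁ δ) ^ 3)⁻¹ + (g (σ₂ δ) ^ 3)⁻¹) / 2) (𝓝[>] 0)
      (𝓝 (-k / 5)) := by
    have := ((hlim3.comp hσ₁).add (hlim3.comp hσ₂)).neg.div_const 2
    rw [show -(k / 5 + k / 5) / 2 = -k / 5 by ring] at this
    refine this.congr' ?_
    filter_upwards [hw] with δ h1
    simp only [Function.comp_apply, h1, inv_neg, Odd.neg_pow (by decide : Odd 3)]
    ring
  have cont : ∀ {f : ℝ → ℝ}, f 0 = 0 → Tendsto f (𝓝[>] 0) (𝓝 0) →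
      ∀ s ⊆ Ioi (0 : ℝ), ContinuousWithinAt f s 0 := fun hf ht s hs => by
    rw [ContinuousWithinAt, hf]
    exact ht.mono_left (nhdsWithin_mono _ hs)
  have extend : ∀ {f f' : ℝ → ℝ} {e : ℝ}, f 0 = 0 → Tendsto f (𝓝[>] 0) (𝓝 0) →
      (∀ᶠ δ in 𝓝[>] 0, HasDerivAt f (f' δ) δ) → Tendsto f' (𝓝[>] 0) (𝓝 e) →
      HasDerivWithinAt f e (Ici 0) 0 := fun {f f' e} hf ht hd he => by
    refine hasDerivWithinAt_Ici_of_tendsto_deriv (s := {δ | 0 < δ ∧ HasDerivAt f (f' δ) δ})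
      (fun δ hδ => hδ.2.differentiableAt.differentiableWithinAt) (cont hf ht _ fun δ hδ => hδ.1)
      (inter_mem self_mem_nhdsWithin hd) (he.congr' (hd.mono fun δ h => h.deriv.symm))
  refine ⟨D, hD0, ?_, extend hD0 hDlim hDd hD'lim⟩
  have hX0' : HasDerivWithinAt X (D 0) (Ici 0) 0 := by
    simpa only [hD0] using extend hX0 hXlim hXd hDlim
  rw [← Ioi_insert, nhdsWithin_insert, eventually_sup, Ioi_insert]
  exact ⟨by simpa using hX0', hXd.mono fun δ h => h.hasDerivWithinAt⟩

/-- for a smooth non-degenerate plane curve `c` parametrized by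
affine arclength with affine curvature `κ`, the gravity curve of `c` at `p` is
flat (its first two one-sided derivatives at `δ = 0` have vanishing determinant)
if and only if `κ'(p) = 0`. -/
theorem stmt0 (I : Set ℝ) (hIo : IsOpen I) (hIc : I.OrdConnected)
    (c : ℝ → ℝ × ℝ) (hc : ContDiffOn ℝ (⊤ : ℕ∞) c I)
    (hdet : ∀ s ∈ I, det2 (iteratedDeriv 1 c s) (iteratedDeriv 2 c s) = 1)
    (κ : ℝ → ℝ)
    (hκ : ∀ s ∈ I, iteratedDeriv 3 c s = -κ s • iteratedDeriv 1 c s)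
    (p : ℝ) (hp : p ∈ I)
    (ε : ℝ) (γ : ℝ → ℝ × ℝ) (hγ : IsGravityCurve c I p ε γ) :
    det2 (derivWithin γ (Set.Ici 0) 0)
        (derivWithin (derivWithin γ (Set.Ici 0)) (Set.Ici 0) 0) = 0 ↔
      deriv κ p = 0 := by
  obtain ⟨hε, hγ0, J, hJI, hJ, hpJ, sm, sp, hs⟩ := hγ
  set P₁ := iteratedDeriv 1 c p with hP₁
  set P₂ := iteratedDeriv 2 c p with hP₂
  have hP : det2 P₁ P₂ = 1 := hdet p hp
  have hdc := fun (n : ℕ) {s : ℝ} (hs : s ∈ I) => hasDerivAt_iteratedDeriv hIo hc n hs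
  have hκp := (differentiableAt_affineCurvature hIo hc hdet hκ hp).hasDerivAt
  have hc0 : ∀ s ∈ I, HasDerivAt (fun s => c s - c p) (iteratedDeriv 1 c s) s := fun s hs => by
    have := hdc 0 hs
    rw [iteratedDeriv_zero] at this
    exact this.sub_const _
  set h : ℝ → ℝ := fun s => -det2 (c s - c p) P₁ with hh_def
  set g : ℝ → ℝ := fun s => -det2 (iteratedDeriv 1 c s) P₁ with hg_def
  set x : ℝ → ℝ := fun s => det2 (c s - c p) P₂ with hx_def
  have hh : ∀ s ∈ I, HasDerivAt h (g s) s := fun s hs =>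
    (hasDerivAt_det2_left (hc0 s hs) P₁).neg
  have hg : ∀ s ∈ I, HasDerivAt g (-det2 (iteratedDeriv 2 c s) P₁) s := fun s hs =>
    (hasDerivAt_det2_left (hdc 1 hs) P₁).neg
  have hg1 : ∀ s ∈ I,
      HasDerivAt (fun s => -det2 (iteratedDeriv 2 c s) P₁) (-κ s * g s) s := fun s hs => by
    refine (hasDerivAt_det2_left (hdc 2 hs) P₁).neg.congr_deriv ?_
    rw [hκ s hs]
    simp only [hg_def, det2, Prod.smul_fst, Prod.smul_snd, smul_eq_mul]
    ring
  have hI' : ∀ᶠ s in 𝓝 p, s ∈ I := hIo.mem_nhds hp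
  have h0 : h p = 0 := by simp [hh_def, det2]
  have g0 : g p = 0 := by simp only [hg_def, det2, ← hP₁]; ring
  have g10 : -det2 (iteratedDeriv 2 c p) P₁ = 1 := by
    rw [← hP, ← hP₂]; simp only [det2]; ring
  have decomp : ∀ s, c s = c p + x s • P₁ + h s • P₂ := fun s => by
    have := hP
    simp only [det2] at this
    ext <;> simp only [hx_def, hh_def, det2, Prod.fst_add, Prod.snd_add, Prod.smul_fst,
      Prod.smul_snd, Prod.fst_sub, Prod.snd_sub, smul_eq_mul]
    · linear_combination (-((c s).1 - (c p).1)) * this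
    · linear_combination (-((c s).2 - (c p).2)) * this
  have hline : ∀ s δ, det2 (c s - (c p + δ • P₂)) P₁ = 0 ↔ h s = δ := fun s δ => by
    have : det2 (c s - (c p + δ • P₂)) P₁ = δ - h s := by
      have := hP
      simp only [hh_def, det2, Prod.fst_add, Prod.snd_add, Prod.smul_fst,
        Prod.smul_snd, Prod.fst_sub, Prod.snd_sub, smul_eq_mul] at this ⊢
      linear_combination δ * this
    rw [this, sub_eq_zero, eq_comm]
  have hval : ∀ δ ∈ Ioo 0 ε, h (sm δ) = δ ∧ h (sp δ) = δ := fun δ hδ =>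
    ⟨(hline _ _).1 (((hs δ hδ).2.2.2.2.1 _ (hs δ hδ).1).2 (Or.inl rfl)),
      (hline _ _).1 (((hs δ hδ).2.2.2.2.1 _ (hs δ hδ).2.1).2 (Or.inr rfl))⟩
  have hσm : ∀ δ ∈ Ioo 0 ε, ∀ s ∈ J ∩ Iio p, h s = δ ↔ s = sm δ := fun δ hδ s hsU =>
    ⟨fun e => (((hs δ hδ).2.2.2.2.1 s hsU.1).1 ((hline _ _).2 e)).resolve_right
      (hsU.2.trans (hs δ hδ).2.2.2.1).ne, fun e => e ▸ (hval δ hδ).1⟩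
  have hσp : ∀ δ ∈ Ioo 0 ε, ∀ s ∈ J ∩ Ioi p, h s = δ ↔ s = sp δ := fun δ hδ s hsU =>
    ⟨fun e => (((hs δ hδ).2.2.2.2.1 s hsU.1).1 ((hline _ _).2 e)).resolve_left
      ((hs δ hδ).2.2.1.trans hsU.2).ne', fun e => e ▸ (hval δ hδ).2⟩
  have hmU : ∀ δ ∈ Ioo 0 ε, sm δ ∈ J ∩ Iio p := fun δ hδ => ⟨(hs δ hδ).1, (hs δ hδ).2.2.1⟩
  have hpU : ∀ δ ∈ Ioo 0 ε, sp δ ∈ J ∩ Ioi p := fun δ hδ =>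
    ⟨(hs δ hδ).2.1, (hs δ hδ).2.2.2.1⟩
  have hsmall : ∀ᶠ δ in 𝓝[>] (0 : ℝ), δ ∈ Ioo 0 ε := Ioo_mem_nhdsGT hε
  have hstrict : ∀ s ∈ I, HasStrictDerivAt h (g s) s := fun s hs =>
    hasStrictDerivAt_of_hasDerivAt_of_continuousAt
      (Filter.mem_of_superset (hIo.mem_nhds hs) hh) (hg s hs).continuousAt
  have hpos : ∀ᶠ s in 𝓝[≠] p, 0 < h s := by
    obtain ⟨a, b⟩ := taylor_of_affine_ode (hI'.mono hh) (hI'.mono hg) (hI'.mono hg1) hκp h0 g0 g10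
    exact (tendsto_inv_sub_signedSqrt a b).1.mono fun s h => h.1
  have hcont : ∀ᶠ s in 𝓝 p, ContinuousAt h s := hI'.mono fun s hs => (hh s hs).continuousAt
  obtain ⟨ρ, hρ, hρJ⟩ := Metric.isOpen_iff.1 hJ p hpJ
  have htm : Tendsto sm (𝓝[>] 0) (𝓝[≠] p) := by
    refine tendsto_inverse_branch hε hmU hσm (fun h => lt_irrefl p h.2) (fun r hr => ?_)
      hcont h0 hpos
    have hm := lt_min hr hρ
    have hsub : uIcc p (p - min r ρ / 2) ⊆ Ioc (p - min r ρ) p := by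
      rw [uIcc_of_ge (by linarith)]
      intro u hu
      exact ⟨by linarith [hu.1], hu.2⟩
    refine ⟨p - min r ρ / 2, by linarith, fun u hu => ?_, fun u hu => ?_⟩
    · have := hsub hu
      rw [Real.ball_eq_Ioo]
      exact ⟨by linarith [this.1, min_le_left r ρ], by linarith [this.2]⟩
    · have := hsub hu
      rcases this.2.eq_or_lt with e | e
      · exact Or.inl e
      · refine Or.inr ⟨hρJ ?_, e⟩
        rw [Real.ball_eq_Ioo]
        exact ⟨by linarith [this.1, min_le_right r ρ], by linarith [this.2]⟩
  have htp : Tendsto sp (𝓝[>] 0) (𝓝[≠] p) := by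
    refine tendsto_inverse_branch hε hpU hσp (fun h => lt_irrefl p h.2) (fun r hr => ?_)
      hcont h0 hpos
    have hm := lt_min hr hρ
    have hsub : uIcc p (p + min r ρ / 2) ⊆ Ico p (p + min r ρ) := by
      rw [uIcc_of_le (by linarith)]
      intro u hu
      exact ⟨hu.1, by linarith [hu.2]⟩
    refine ⟨p + min r ρ / 2, by linarith, fun u hu => ?_, fun u hu => ?_⟩
    · have := hsub hu
      rw [Real.ball_eq_Ioo]
      exact ⟨by linarith [this.1], by linarith [this.2, min_le_left r ρ]⟩
    · have := hsub hu
      rcases this.1.eq_or_lt with e | e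
      · exact Or.inl e.symm
      · refine Or.inr ⟨hρJ ?_, e⟩
        rw [Real.ball_eq_Ioo]
        exact ⟨by linarith [this.1], by linarith [this.2, min_le_right r ρ]⟩
  set X : ℝ → ℝ := fun δ => if δ = 0 then 0 else (x (sm δ) + x (sp δ)) / 2 with hX_def
  have hγX : ∀ δ ∈ Ico 0 ε, γ δ = c p + X δ • P₁ + δ • P₂ := fun δ hδ => by
    rcases hδ.1.eq_or_lt with rfl | hpos
    · simp [hX_def, hγ0]
    · obtain ⟨-, -, -, -, -, e⟩ := hs δ ⟨hpos, hδ.2⟩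
      obtain ⟨e1, e2⟩ := hval δ ⟨hpos, hδ.2⟩
      rw [e, decomp (sm δ), decomp (sp δ), e1, e2]
      simp only [hX_def, hpos.ne', if_false]
      module
  obtain ⟨D, hD0, hXD, hDD⟩ := exists_deriv_average_branches (X := X) (x := x) (σ₁ := sm)
    (σ₂ := sp) (x1 := fun s => det2 (iteratedDeriv 1 c s) P₂)
    (x2 := fun s => det2 (iteratedDeriv 2 c s) P₂)
    (hI'.mono hh) (hI'.mono hg) (hI'.mono hg1) hκp h0 g0 g10
    (hI'.mono fun s hs => hasDerivAt_det2_left (hc0 s hs) P₂)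
    (hI'.mono fun s hs => hasDerivAt_det2_left (hdc 1 hs) P₂)
    (by simp [hx_def, det2]) hP (by simp only [det2, ← hP₂]; ring)
    (hI'.mono fun s hs => by
      have e1 := hdet s hs
      have e2 := hP
      simp only [hg_def, det2] at e1 e2 ⊢
      linear_combination (-(P₁.1 * P₂.2 - P₁.2 * P₂.1)) * e1 - e2)
    htm htp
    (hsmall.mono fun δ hδ => (hmU δ hδ).2) (hsmall.mono fun δ hδ => (hpU δ hδ).2)
    (hsmall.mono fun δ hδ => (hval δ hδ).1) (hsmall.mono fun δ hδ => (hval δ hδ).2)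
    (hsmall.mono fun δ hδ => hasDerivAt_inverse_branch (hJ.inter isOpen_Iio) hmU hσm hδ
      (hstrict _ (hJI (hmU δ hδ).1)))
    (hsmall.mono fun δ hδ => hasDerivAt_inverse_branch (hJ.inter isOpen_Ioi) hpU hσp hδ
      (hstrict _ (hJI (hpU δ hδ).1)))
    (by simp [hX_def]) (hsmall.mono fun δ hδ => by simp [hX_def, hδ.1.ne'])
  have hud : UniqueDiffOn ℝ (Ici (0 : ℝ)) := uniqueDiffOn_Ici 0
  have hev : ∀ᶠ δ in 𝓝[≥] (0 : ℝ), γ δ = c p + X δ • P₁ + δ • P₂ := by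
    filter_upwards [Ico_mem_nhdsGE hε] with δ hδ using hγX δ hδ
  have hγ' : ∀ᶠ δ in 𝓝[≥] (0 : ℝ), derivWithin γ (Ici 0) δ = D δ • P₁ + P₂ := by
    filter_upwards [eventually_eventually_nhdsWithin.2 hev, hXD, self_mem_nhdsWithin]
      with δ h1 h2 h3
    have := ((h2.smul_const P₁).const_add (c p)).add ((hasDerivWithinAt_id δ (Ici 0)).smul_const P₂)
    rw [one_smul] at this
    exact (this.congr_of_eventuallyEq_of_mem h1 h3).derivWithin (hud δ h3)
  have h00 : (0 : ℝ) ∈ Ici (0 : ℝ) := self_mem_Ici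
  have hγ'' : derivWithin (derivWithin γ (Ici 0)) (Ici 0) 0 = (-deriv κ p / 5) • P₁ :=
    (((hDD.smul_const P₁).add_const P₂).congr_of_eventuallyEq_of_mem hγ' h00).derivWithin
      (hud 0 h00)
  rw [hγ'', hγ'.self_of_nhdsWithin h00, hD0, zero_smul, zero_add]
  have : det2 P₂ ((-deriv κ p / 5) • P₁) = deriv κ p / 5 := by
    have := hP
    simp only [det2, Prod.smul_fst, Prod.smul_snd, smul_eq_mul] at this ⊢
    linear_combination (deriv κ p / 5) * this
  rw [this]
  simp

end
end

section
/- Let c : I → ℝ² be a real-analytic non-degenerate plane curve parametrized by affine arclength, with affine curvature κ. Then the gravity curve γ_p of c at p is a straight line for every p ∈ I if and only if κ is constant on I. -/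
open Set

noncomputable section

open Filter Topology

/-- If the two branches `P`, `-M` of the level sets of `y` have midpoints on a line, then the
fourth order coefficient `k₁` of the pair `(x, y)` vanishes. -/
theorem coeff_eq_zero_of_midpoint_collinear {ι : Type*} {l : Filter ι} [l.NeBot]
    {k k₁ a : ℝ} {x y : ℝ → ℝ} {P M : ι → ℝ}
    (hx : Tendsto (fun u => (x u - (u - k * u ^ 3 / 6)) / u ^ 4) (𝓝[≠] 0) (𝓝 (-k₁ / 24)))
    (hy : Tendsto (fun u => (y u - (u ^ 2 / 2 - k * u ^ 4 / 24)) / u ^ 5) (𝓝[≠] 0)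
      (𝓝 (-k₁ / 60)))
    (hP : Tendsto P l (𝓝[>] 0)) (hM : Tendsto M l (𝓝[>] 0))
    (hlevel : ∀ᶠ i in l, y (P i) = y (-M i))
    (hline : ∀ᶠ i in l, x (P i) + x (-M i) = 2 * a * y (P i)) : k₁ = 0 := by
  set X : ℝ → ℝ := fun u => (x u - (u - k * u ^ 3 / 6)) / u ^ 4 with hX
  set Y : ℝ → ℝ := fun u => (y u - (u ^ 2 / 2 - k * u ^ 4 / 24)) / u ^ 5 with hY
  have hxX : ∀ u, u ≠ 0 → x u = u - k * u ^ 3 / 6 + u ^ 4 * X u := by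
    intro u hu; simp only [hX]; field_simp; ring
  have hyY : ∀ u, u ≠ 0 → y u = u ^ 2 / 2 - k * u ^ 4 / 24 + u ^ 5 * Y u := by
    intro u hu; simp only [hY]; field_simp; ring
  have hP0 : Tendsto P l (𝓝 0) := hP.mono_right nhdsWithin_le_nhds
  have hM0 : Tendsto M l (𝓝 0) := hM.mono_right nhdsWithin_le_nhds
  have hPpos : ∀ᶠ i in l, 0 < P i := (tendsto_nhdsWithin_iff.1 hP).2
  have hMpos : ∀ᶠ i in l, 0 < M i := (tendsto_nhdsWithin_iff.1 hM).2
  have hPne : Tendsto P l (𝓝[≠] 0) :=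
    tendsto_nhdsWithin_iff.2 ⟨hP0, hPpos.mono fun i hi => hi.ne'⟩
  have hMne : Tendsto (fun i => -M i) l (𝓝[≠] 0) :=
    tendsto_nhdsWithin_iff.2 ⟨by simpa using hM0.neg, hMpos.mono fun i hi => by simpa using hi.ne'⟩
  have hXP := hx.comp hPne
  have hXM := hx.comp hMne
  have hYP := hy.comp hPne
  have hYM := hy.comp hMne
  simp only [Function.comp_def] at hXP hXM hYP hYM
  set S : ι → ℝ := fun i => P i + M i with hS
  have hS0 : Tendsto S l (𝓝 0) := by simpa using hP0.add hM0
  set α : ι → ℝ := fun i => P i / S i with hα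
  set β : ι → ℝ := fun i => M i / S i with hβ
  have hbasic : ∀ᶠ i in l, 0 < S i ∧ 0 < α i ∧ 0 < β i ∧ α i + β i = 1 ∧
      P i = S i * α i ∧ M i = S i * β i := by
    filter_upwards [hPpos, hMpos] with i h1 h2
    have hSi : 0 < S i := add_pos h1 h2
    refine ⟨hSi, div_pos h1 hSi, div_pos h2 hSi, ?_, ?_, ?_⟩
    · simp only [hα, hβ]; rw [← add_div]; exact div_self hSi.ne'
    · simp only [hα]; field_simp
    · simp only [hβ]; field_simp
  have hdiff : ∀ᶠ i in l, α i - β i = k * S i ^ 2 * ((α i - β i) * (α i ^ 2 + β i ^ 2)) / 12 -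
      2 * S i ^ 3 * (α i ^ 5 * Y (P i) + β i ^ 5 * Y (-M i)) := by
    filter_upwards [hPpos, hMpos, hlevel, hbasic] with i h1 h2 h3 ⟨h4, h5, h6, h7, h8, h9⟩
    rw [hyY _ h1.ne', hyY (-M i) (by simpa using h2.ne')] at h3
    generalize Y (P i) = A at *
    generalize Y (-M i) = B at *
    rw [h8, h9] at h3
    have hb : β i = 1 - α i := by linarith
    rw [hb] at h3 ⊢
    have : S i ^ 2 ≠ 0 := by positivity
    apply mul_left_cancel₀ this
    linear_combination 2 * h3
  have hd0 : Tendsto (fun i => α i - β i) l (𝓝 0) := by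
    have hbound : Tendsto (fun i => |k| * S i ^ 2 * 2 + 2 * S i ^ 3 * (|Y (P i)| + |Y (-M i)|)) l
        (𝓝 (|k| * 0 ^ 2 * 2 + 2 * 0 ^ 3 * (|-k₁ / 60| + |-k₁ / 60|))) :=
      (((hS0.pow 2).const_mul _).mul_const _).add
        (((hS0.pow 3).const_mul _).mul (hYP.abs.add hYM.abs))
    have hbound0 : Tendsto (fun i => |k| * S i ^ 2 * 2 + 2 * S i ^ 3 * (|Y (P i)| + |Y (-M i)|)) l
        (𝓝 0) := by simpa using hbound
    refine squeeze_zero_norm' ?_ hbound0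
    filter_upwards [hdiff, hbasic] with i hi ⟨h4, h5, h6, h7, h8, h9⟩
    rw [Real.norm_eq_abs, hi]
    have ha1 : α i ≤ 1 := by linarith
    have hb1 : β i ≤ 1 := by linarith
    have e1 : |(α i - β i) * (α i ^ 2 + β i ^ 2)| ≤ 2 := by
      rw [abs_mul]
      have q1 : |α i - β i| ≤ 1 := abs_le.2 ⟨by linarith, by linarith⟩
      have q2 : |α i ^ 2 + β i ^ 2| ≤ 2 := by
        rw [abs_of_pos (by positivity)]
        have := pow_le_one₀ (n := 2) h5.le ha1
        have := pow_le_one₀ (n := 2) h6.le hb1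
        linarith
      nlinarith [abs_nonneg (α i - β i), abs_nonneg (α i ^ 2 + β i ^ 2)]
    have e2 : |α i ^ 5 * Y (P i) + β i ^ 5 * Y (-M i)| ≤ |Y (P i)| + |Y (-M i)| := by
      refine (abs_add_le _ _).trans (add_le_add ?_ ?_)
      · rw [abs_mul, abs_of_pos (by positivity)]
        exact mul_le_of_le_one_left (abs_nonneg _) (pow_le_one₀ h5.le ha1)
      · rw [abs_mul, abs_of_pos (by positivity)]
        exact mul_le_of_le_one_left (abs_nonneg _) (pow_le_one₀ h6.le hb1)
    refine (abs_sub _ _).trans (add_le_add ?_ ?_)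
    · rw [abs_div, abs_mul, abs_mul, abs_of_pos (show (0 : ℝ) < S i ^ 2 by positivity),
        abs_of_pos (show (0 : ℝ) < 12 by norm_num)]
      have : |k| * S i ^ 2 * |(α i - β i) * (α i ^ 2 + β i ^ 2)| ≤ |k| * S i ^ 2 * 2 := by gcongr
      have : 0 ≤ |k| * S i ^ 2 * |(α i - β i) * (α i ^ 2 + β i ^ 2)| := by positivity
      linarith
    · rw [abs_mul, abs_of_pos (show (0 : ℝ) < 2 * S i ^ 3 by positivity)]
      gcongr
  have hα2 : Tendsto α l (𝓝 (1 / 2)) := by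
    have : Tendsto (fun i => (1 + (α i - β i)) / 2) l (𝓝 ((1 + 0) / 2)) :=
      (hd0.const_add 1).div_const 2
    rw [add_zero] at this
    refine this.congr' ?_
    filter_upwards [hbasic] with i ⟨_, _, _, h7, _, _⟩
    linarith
  have hβ2 : Tendsto β l (𝓝 (1 / 2)) := by
    have : Tendsto (fun i => α i - (α i - β i)) l (𝓝 (1 / 2 - 0)) := hα2.sub hd0
    simpa using this
  have hω : Tendsto (fun i => (α i - β i) / S i ^ 3) l (𝓝 (k₁ / 480)) := by
    have h1 : Tendsto (fun i => 1 - k * S i ^ 2 * (α i ^ 2 + β i ^ 2) / 12) l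
        (𝓝 (1 - k * 0 ^ 2 * ((1 / 2) ^ 2 + (1 / 2) ^ 2) / 12)) :=
      ((((hS0.pow 2).const_mul k).mul ((hα2.pow 2).add (hβ2.pow 2))).div_const 12).const_sub 1
    have h2 : Tendsto (fun i => -2 * (α i ^ 5 * Y (P i) + β i ^ 5 * Y (-M i))) l
        (𝓝 (-2 * ((1 / 2) ^ 5 * (-k₁ / 60) + (1 / 2) ^ 5 * (-k₁ / 60)))) :=
      (((hα2.pow 5).mul hYP).add ((hβ2.pow 5).mul hYM)).const_mul _
    have h3 := h2.div h1 (by norm_num)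
    have hne := h1.eventually_ne (b₂ := 0) (by norm_num)
    have hval : -2 * ((1 / 2) ^ 5 * (-k₁ / 60) + (1 / 2) ^ 5 * (-k₁ / 60)) /
      (1 - k * 0 ^ 2 * ((1 / 2) ^ 2 + (1 / 2) ^ 2) / 12) = k₁ / 480 := by norm_num; ring
    rw [hval] at h3
    refine h3.congr' ?_
    filter_upwards [hne, hdiff, hbasic] with i hi hd ⟨h4, _⟩
    simp only [Pi.div_apply]
    rw [div_eq_div_iff hi (by positivity)]
    linear_combination -hd
  have hlhs : Tendsto (fun i => (α i - β i) / S i ^ 3 *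
      (1 - k * S i ^ 2 * (α i ^ 2 + α i * β i + β i ^ 2) / 6) +
      (α i ^ 4 * X (P i) + β i ^ 4 * X (-M i))) l
      (𝓝 (k₁ / 480 * (1 - k * 0 ^ 2 * ((1 / 2) ^ 2 + 1 / 2 * (1 / 2) + (1 / 2) ^ 2) / 6) +
        ((1 / 2) ^ 4 * (-k₁ / 24) + (1 / 2) ^ 4 * (-k₁ / 24)))) :=
    (hω.mul (((((hS0.pow 2).const_mul k).mul
      (((hα2.pow 2).add (hα2.mul hβ2)).add (hβ2.pow 2))).div_const 6).const_sub 1)).add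
      (((hα2.pow 4).mul hXP).add ((hβ2.pow 4).mul hXM))
  have hrhs : Tendsto (fun i => 2 * a * (α i ^ 2 / 2 - k * S i ^ 2 * α i ^ 4 / 24 +
      S i ^ 3 * (α i ^ 5 * Y (P i)))) l (𝓝 (2 * a * ((1 / 2) ^ 2 / 2 -
        k * 0 ^ 2 * (1 / 2) ^ 4 / 24 + 0 ^ 3 * ((1 / 2) ^ 5 * (-k₁ / 60))))) :=
    (((((hα2.pow 2).div_const 2).sub ((((hS0.pow 2).const_mul k).mul (hα2.pow 4)).div_const 24)).add
      ((hS0.pow 3).mul ((hα2.pow 5).mul hYP)))).const_mul _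
  have heq : ∀ᶠ i in l, S i ^ 2 * ((α i - β i) / S i ^ 3 *
      (1 - k * S i ^ 2 * (α i ^ 2 + α i * β i + β i ^ 2) / 6) +
      (α i ^ 4 * X (P i) + β i ^ 4 * X (-M i))) =
      2 * a * (α i ^ 2 / 2 - k * S i ^ 2 * α i ^ 4 / 24 + S i ^ 3 * (α i ^ 5 * Y (P i))) := by
    filter_upwards [hPpos, hMpos, hline, hbasic] with i h1 h2 h3 ⟨h4, h5, h6, h7, h8, h9⟩
    rw [hyY _ h1.ne', hxX _ h1.ne', hxX (-M i) (by simpa using h2.ne')] at h3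
    generalize Y (P i) = A at *
    generalize X (P i) = B at *
    generalize X (-M i) = C at *
    rw [h8, h9] at h3
    have : S i ^ 2 ≠ 0 := by positivity
    have hcancel : (α i - β i) / S i ^ 3 * S i ^ 3 = α i - β i :=
      div_mul_cancel₀ _ (by positivity)
    apply mul_left_cancel₀ this
    linear_combination h3 + S i * (1 - k * S i ^ 2 * (α i ^ 2 + α i * β i + β i ^ 2) / 6) * hcancel
  have ha : a = 0 := by
    have h1 := ((hS0.pow 2).mul hlhs).congr' heq
    have h2 := tendsto_nhds_unique h1 hrhs
    norm_num at h2
    linarith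
  have h0 : Tendsto (fun _ : ι => (0 : ℝ)) l _ := hlhs.congr' (by
    filter_upwards [heq, hbasic] with i hi ⟨h4, _⟩
    rw [ha, mul_zero, zero_mul] at hi
    exact (mul_eq_zero.1 hi).resolve_left (by positivity))
  have := tendsto_nhds_unique h0 tendsto_const_nhds
  norm_num at this
  linarith

/-- A function with a positive second derivative at a critical point `p` is strictly decreasing just
before `p` and strictly
increasing just after `p`. -/
theorem exists_strictAntiOn_strictMonoOn {f : ℝ → ℝ} {p : ℝ} (hf : AnalyticAt ℝ f p)
    (h1 : deriv f p = 0) (h2 : 0 < deriv (deriv f) p) {U : Set ℝ} (hU : U ∈ 𝓝 p) :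
    ∃ η > 0, Icc (p - η) (p + η) ⊆ U ∧ ContinuousOn f (Icc (p - η) (p + η)) ∧
      StrictAntiOn f (Icc (p - η) p) ∧ StrictMonoOn f (Icc p (p + η)) := by
  have hpos : ∀ᶠ s in 𝓝 p, 0 < deriv (deriv f) s :=
    hf.deriv.deriv.continuousAt.eventually (lt_mem_nhds h2)
  obtain ⟨η, hη, hsub⟩ := (nhds_basis_Icc_pos p).mem_iff.1
    (inter_mem (inter_mem hU hf.eventually_analyticAt) hpos)
  have hcf : ContinuousOn f (Icc (p - η) (p + η)) := fun s hs =>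
    (hsub hs).1.2.continuousAt.continuousWithinAt
  have hcf' : ContinuousOn (deriv f) (Icc (p - η) (p + η)) := fun s hs =>
    (hsub hs).1.2.deriv.continuousAt.continuousWithinAt
  have hmono : StrictMonoOn (deriv f) (Icc (p - η) (p + η)) :=
    strictMonoOn_of_deriv_pos (convex_Icc _ _) hcf' fun s hs => (hsub (interior_subset hs)).2
  have hp : p ∈ Icc (p - η) (p + η) := ⟨by linarith, by linarith⟩
  have hl : Icc (p - η) p ⊆ Icc (p - η) (p + η) := Icc_subset_Icc_right hp.2
  have hr : Icc p (p + η) ⊆ Icc (p - η) (p + η) := Icc_subset_Icc_left hp.1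
  refine ⟨η, hη, fun s hs => (hsub hs).1.1, hcf, ?_, ?_⟩
  · refine strictAntiOn_of_deriv_neg (convex_Icc _ _) (hcf.mono hl) fun s hs => ?_
    rw [interior_Icc] at hs
    exact h1 ▸ hmono (hl (Ioo_subset_Icc_self hs)) hp hs.2
  · refine strictMonoOn_of_deriv_pos (convex_Icc _ _) (hcf.mono hr) fun s hs => ?_
    rw [interior_Icc] at hs
    exact h1 ▸ hmono hp (hr (Ioo_subset_Icc_self hs)) hs.1

/-- Uniqueness for the linear system `(f, f₁, f₂) ↦ (f₁, f₂, -r f₁)` with vanishing initial data. -/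
theorem eq_zero_of_third_order_ode {r η : ℝ} {f f₁ f₂ : ℝ → ℝ}
    (hf : ∀ u ∈ Ioo (-η) η, HasDerivAt f (f₁ u) u)
    (hf₁ : ∀ u ∈ Ioo (-η) η, HasDerivAt f₁ (f₂ u) u)
    (hf₂ : ∀ u ∈ Ioo (-η) η, HasDerivAt f₂ (-r * f₁ u) u)
    (h : f 0 = 0) (h₁ : f₁ 0 = 0) (h₂ : f₂ 0 = 0) :
    ∀ u ∈ Ioo (-η) η, f u = 0 := by
  intro u hu
  have h0 : (0 : ℝ) ∈ Ioo (-η) η := by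
    have := hu.1.trans hu.2
    constructor <;> linarith
  let L : ℝ × ℝ × ℝ →L[ℝ] ℝ × ℝ × ℝ :=
    ((ContinuousLinearMap.fst ℝ ℝ ℝ).comp (ContinuousLinearMap.snd ℝ ℝ (ℝ × ℝ))).prod
      (((ContinuousLinearMap.snd ℝ ℝ ℝ).comp (ContinuousLinearMap.snd ℝ ℝ (ℝ × ℝ))).prod
        (-r • (ContinuousLinearMap.fst ℝ ℝ ℝ).comp (ContinuousLinearMap.snd ℝ ℝ (ℝ × ℝ))))
  have key := ODE_solution_unique_of_mem_Ioo (v := fun _ => L) (s := fun _ => univ)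
    (f := fun t => (f t, f₁ t, f₂ t)) (g := fun _ => 0)
    (fun _ _ => L.lipschitz.lipschitzOnWith) h0
    (fun t ht => ⟨by
      simpa [L] using (hf t ht).prodMk ((hf₁ t ht).prodMk (hf₂ t ht)), mem_univ _⟩)
    (fun t _ => ⟨by simpa using hasDerivAt_const t (0 : ℝ × ℝ × ℝ), mem_univ _⟩)
    (by simp [h, h₁, h₂]) hu
  exact congrArg Prod.fst key

/-- The level sets of a strict valley consist of two branches tending to its bottom. -/
theorem exists_level_branches {f : ℝ → ℝ} {p η : ℝ} (hη : 0 < η)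
    (hc : ContinuousOn f (Icc (p - η) (p + η))) (hanti : StrictAntiOn f (Icc (p - η) p))
    (hmono : StrictMonoOn f (Icc p (p + η))) (hp : f p = 0) :
    ∃ ε > 0, ∃ sm sp : ℝ → ℝ,
      (∀ δ ∈ Ioo 0 ε, sm δ ∈ Ioo (p - η) p ∧ sp δ ∈ Ioo p (p + η) ∧
        ∀ s ∈ Ioo (p - η) (p + η), f s = δ ↔ s = sm δ ∨ s = sp δ) ∧
      Tendsto sm (𝓝[>] 0) (𝓝 p) ∧ Tendsto sp (𝓝[>] 0) (𝓝 p) := by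
  have hl : ∀ e, 0 < e → e ≤ η → 0 < f (p - e) := fun e he he' =>
    hp ▸ hanti ⟨by linarith, by linarith⟩ ⟨by linarith, le_rfl⟩ (by linarith)
  have hr : ∀ e, 0 < e → e ≤ η → 0 < f (p + e) := fun e he he' =>
    hp ▸ hmono ⟨le_rfl, by linarith⟩ ⟨by linarith, by linarith⟩ (by linarith)
  have hsm : ∀ δ ∈ Ioo 0 (min (f (p - η)) (f (p + η))), ∃ s ∈ Ioo (p - η) p, f s = δ := by
    intro δ hδ
    exact intermediate_value_Ioo' (by linarith) (hc.mono (Icc_subset_Icc_right (by linarith)))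
      ⟨hp ▸ hδ.1, hδ.2.trans_le (min_le_left _ _)⟩
  have hsp : ∀ δ ∈ Ioo 0 (min (f (p - η)) (f (p + η))), ∃ s ∈ Ioo p (p + η), f s = δ := by
    intro δ hδ
    exact intermediate_value_Ioo (by linarith) (hc.mono (Icc_subset_Icc_left (by linarith)))
      ⟨hp ▸ hδ.1, hδ.2.trans_le (min_le_right _ _)⟩
  choose! sm hsm hsm' using hsm
  choose! sp hsp hsp' using hsp
  have hε : 0 < min (f (p - η)) (f (p + η)) := lt_min (hl η hη le_rfl) (hr η hη le_rfl)
  refine ⟨_, hε, sm, sp, fun δ hδ => ⟨hsm δ hδ, hsp δ hδ, fun s hs => ⟨fun h => ?_, ?_⟩⟩, ?_, ?_⟩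
  · rcases le_total s p with h' | h'
    · exact Or.inl (hanti.injOn ⟨hs.1.le, h'⟩ (Ioo_subset_Icc_self (hsm δ hδ))
        (h.trans (hsm' δ hδ).symm))
    · exact Or.inr (hmono.injOn ⟨h', hs.2.le⟩ (Ioo_subset_Icc_self (hsp δ hδ))
        (h.trans (hsp' δ hδ).symm))
  · rintro (rfl | rfl)
    · exact hsm' δ hδ
    · exact hsp' δ hδ
  · rw [Metric.tendsto_nhds]
    intro e he
    have he' : 0 < min e η := lt_min he hη
    filter_upwards [Ioo_mem_nhdsGT hε, Ioo_mem_nhdsGT (hl _ he' (min_le_right _ _))] with δ h1 h2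
    have h3 : p - min e η < sm δ := by
      by_contra! hcon
      have := hanti.antitoneOn (Ioo_subset_Icc_self (hsm δ h1))
        ⟨by linarith [min_le_right e η], by linarith⟩ hcon
      rw [hsm' δ h1] at this
      linarith [h2.2]
    rw [Real.dist_eq, abs_lt]
    constructor <;> linarith [min_le_left e η, (hsm δ h1).2]
  · rw [Metric.tendsto_nhds]
    intro e he
    have he' : 0 < min e η := lt_min he hη
    filter_upwards [Ioo_mem_nhdsGT hε, Ioo_mem_nhdsGT (hr _ he' (min_le_right _ _))] with δ h1 h2
    have h3 : sp δ < p + min e η := by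
      by_contra! hcon
      have := hmono.monotoneOn ⟨by linarith, by linarith [min_le_right e η]⟩
        (Ioo_subset_Icc_self (hsp δ h1)) hcon
      rw [hsp' δ h1] at this
      linarith [h2.2]
    rw [Real.dist_eq, abs_lt]
    constructor <;> linarith [min_le_left e η, (hsp δ h1).1]

/-- `det2` as a continuous linear map in its second argument. -/
def det2L (v : ℝ × ℝ) : ℝ × ℝ →L[ℝ] ℝ :=
  v.1 • ContinuousLinearMap.snd ℝ ℝ ℝ - v.2 • ContinuousLinearMap.fst ℝ ℝ ℝ

theorem det2L_apply (v w : ℝ × ℝ) : det2L v w = v.1 * w.2 - v.2 * w.1 := by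
  simp [det2L]

theorem det2L_self (v : ℝ × ℝ) : det2L v v = 0 := by
  rw [det2L_apply]; ring

theorem hasDerivAt_iteratedDeriv_s2 {c : ℝ → ℝ × ℝ} {s : ℝ} (hc : AnalyticAt ℝ c s) (n : ℕ) :
    HasDerivAt (iteratedDeriv n c) (iteratedDeriv (n + 1) c s) s := by
  rw [iteratedDeriv_succ, iteratedDeriv_eq_iterate]
  exact (hc.iterated_deriv n).differentiableAt.hasDerivAt

/-- Near a point of non-degeneracy, the height over the tangent line is a strict valley. -/
theorem exists_height_valley {c : ℝ → ℝ × ℝ} {p : ℝ} (hc : AnalyticAt ℝ c p)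
    (hdet : det2 (iteratedDeriv 1 c p) (iteratedDeriv 2 c p) = 1) {U : Set ℝ} (hU : U ∈ 𝓝 p) :
    ∃ η > 0, Icc (p - η) (p + η) ⊆ U ∧
      ContinuousOn (fun s => det2L (iteratedDeriv 1 c p) (c s - c p)) (Icc (p - η) (p + η)) ∧
      StrictAntiOn (fun s => det2L (iteratedDeriv 1 c p) (c s - c p)) (Icc (p - η) p) ∧
      StrictMonoOn (fun s => det2L (iteratedDeriv 1 c p) (c s - c p)) (Icc p (p + η)) := by
  set L := det2L (iteratedDeriv 1 c p) with hL
  have hd : ∀ s, AnalyticAt ℝ c s →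
      HasDerivAt (fun s => L (c s - c p)) (L (iteratedDeriv 1 c s)) s := fun s hs => by
    have := hasDerivAt_iteratedDeriv_s2 hs 0
    rw [iteratedDeriv_zero] at this
    exact L.hasFDerivAt.comp_hasDerivAt s (this.sub_const _)
  have hd1 : HasDerivAt (fun s => L (iteratedDeriv 1 c s)) (L (iteratedDeriv 2 c p)) p :=
    L.hasFDerivAt.comp_hasDerivAt p (hasDerivAt_iteratedDeriv_s2 hc 1)
  have hev : deriv (fun s => L (c s - c p)) =ᶠ[𝓝 p] fun s => L (iteratedDeriv 1 c s) := by
    filter_upwards [hc.eventually_analyticAt] with s hs using (hd s hs).deriv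
  refine exists_strictAntiOn_strictMonoOn ?_ ?_ ?_ hU
  · exact (L.analyticAt _).comp (hc.sub analyticAt_const)
  · rw [(hd p hc).deriv, hL, det2L_self]
  · rw [hev.deriv_eq, hd1.deriv, hL, det2L_apply]
    rw [det2] at hdet
    linarith

theorem det2_line_eq_zero_iff {c : ℝ → ℝ × ℝ} {p δ s : ℝ}
    (hdet : det2 (iteratedDeriv 1 c p) (iteratedDeriv 2 c p) = 1) :
    det2 (c s - (c p + δ • iteratedDeriv 2 c p)) (iteratedDeriv 1 c p) = 0 ↔
      det2L (iteratedDeriv 1 c p) (c s - c p) = δ := by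
  rw [det2L_apply]
  simp only [det2, Prod.fst_sub, Prod.snd_sub, Prod.fst_add, Prod.snd_add, Prod.smul_fst,
    Prod.smul_snd, smul_eq_mul] at hdet ⊢
  constructor <;> intro h
  · linear_combination -h + δ * hdet
  · linear_combination -h + δ * hdet

/-- Taylor expansion of a linear coordinate of an analytic curve. -/
theorem tendsto_taylor_coord {c : ℝ → ℝ × ℝ} {I : Set ℝ} (hIo : IsOpen I) (hIc : I.OrdConnected)
    (hc : AnalyticOnNhd ℝ c I) {p : ℝ} (hp : p ∈ I) (L : ℝ × ℝ →L[ℝ] ℝ) (n : ℕ) :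
    Tendsto (fun u => (L (c (p + u)) - ∑ k ∈ Finset.range (n + 1),
      ((k.factorial : ℝ)⁻¹ * u ^ k) * L (iteratedDeriv k c p)) / u ^ n) (𝓝[≠] 0) (𝓝 0) := by
  have h := taylor_tendsto (n := n) hIc.convex hp hc.analyticOn.contDiffOn_of_completeSpace
  rw [hIo.nhdsWithin_eq hp] at h
  have hsh : Tendsto (fun u : ℝ => p + u) (𝓝[≠] 0) (𝓝 p) := by
    have : Tendsto (fun u : ℝ => p + u) (𝓝 0) (𝓝 (p + 0)) := tendsto_id.const_add p
    rw [add_zero] at this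
    exact this.mono_left nhdsWithin_le_nhds
  have h2 := (L.continuous.tendsto _).comp (h.comp hsh)
  rw [map_zero] at h2
  refine h2.congr fun u => ?_
  simp only [Function.comp_def, taylor_within_apply, add_sub_cancel_left, map_smul, map_sub,
    map_sum, smul_eq_mul, iteratedDerivWithin_of_isOpen hIo hp]
  rw [div_eq_inv_mul]

/-- Gravity curves exist, with branches tending to the base point. -/
theorem exists_isGravityCurve {c : ℝ → ℝ × ℝ} {I : Set ℝ} (hIo : IsOpen I)
    (hc : AnalyticOnNhd ℝ c I) {p : ℝ} (hp : p ∈ I)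
    (hdet : det2 (iteratedDeriv 1 c p) (iteratedDeriv 2 c p) = 1) :
    ∃ ε > 0, ∃ sm sp : ℝ → ℝ, ∃ γ : ℝ → ℝ × ℝ, IsGravityCurve c I p ε γ ∧
      (∀ δ ∈ Ioo 0 ε, sm δ < p ∧ p < sp δ ∧
        det2L (iteratedDeriv 1 c p) (c (sm δ) - c p) = δ ∧
        det2L (iteratedDeriv 1 c p) (c (sp δ) - c p) = δ ∧
        γ δ = (2⁻¹ : ℝ) • (c (sm δ) + c (sp δ))) ∧
      Tendsto sm (𝓝[>] 0) (𝓝 p) ∧ Tendsto sp (𝓝[>] 0) (𝓝 p) := by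
  obtain ⟨η, hη, hsub, hcont, hanti, hmono⟩ :=
    exists_height_valley (hc p hp) hdet (hIo.mem_nhds hp)
  obtain ⟨ε, hε, sm, sp, hbr, htm, htp⟩ :=
    exists_level_branches hη hcont hanti hmono (by simp)
  have hm : ∀ δ ∈ Ioo 0 ε, sm δ ∈ Ioo (p - η) (p + η) := fun δ hδ =>
    ⟨(hbr δ hδ).1.1, by linarith [(hbr δ hδ).1.2]⟩
  have hp' : ∀ δ ∈ Ioo 0 ε, sp δ ∈ Ioo (p - η) (p + η) := fun δ hδ =>
    ⟨by linarith [(hbr δ hδ).2.1.1], (hbr δ hδ).2.1.2⟩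
  classical
  let γ : ℝ → ℝ × ℝ := fun δ => if δ = 0 then c p else (2⁻¹ : ℝ) • (c (sm δ) + c (sp δ))
  have hγ : ∀ δ ∈ Ioo 0 ε, γ δ = (2⁻¹ : ℝ) • (c (sm δ) + c (sp δ)) := fun δ hδ =>
    if_neg hδ.1.ne'
  refine ⟨ε, hε, sm, sp, γ, ⟨hε, if_pos rfl, Ioo (p - η) (p + η),
    Ioo_subset_Icc_self.trans hsub, isOpen_Ioo, ⟨by linarith, by linarith⟩, sm, sp,
    fun δ hδ => ⟨hm δ hδ, hp' δ hδ, (hbr δ hδ).1.2, (hbr δ hδ).2.1.1,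
      fun s hs => (det2_line_eq_zero_iff hdet).trans ((hbr δ hδ).2.2 s hs), hγ δ hδ⟩⟩,
    fun δ hδ => ⟨(hbr δ hδ).1.2, (hbr δ hδ).2.1.1, ?_, ?_, hγ δ hδ⟩, htm, htp⟩
  · exact ((hbr δ hδ).2.2 _ (hm δ hδ)).2 (Or.inl rfl)
  · exact ((hbr δ hδ).2.2 _ (hp' δ hδ)).2 (Or.inr rfl)

/-- If the affine curvature is constant near `p`, the curve has an affine reflection symmetry
at `p`. -/
theorem reflection_symmetry {c : ℝ → ℝ × ℝ} {p r η : ℝ}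
    (hc : AnalyticOnNhd ℝ c (Ioo (p - η) (p + η)))
    (hr : ∀ s ∈ Ioo (p - η) (p + η), iteratedDeriv 3 c s = -r • iteratedDeriv 1 c s)
    {u : ℝ} (hu : u ∈ Ioo (-η) η) :
    det2L (iteratedDeriv 1 c p) (c (p + u) - c p) = det2L (iteratedDeriv 1 c p) (c (p - u) - c p) ∧
      det2L (iteratedDeriv 2 c p) (c (p + u) - c p + (c (p - u) - c p)) = 0 := by
  have hplus : ∀ u ∈ Ioo (-η) η, p + u ∈ Ioo (p - η) (p + η) := fun u hu =>
    ⟨by linarith [hu.1], by linarith [hu.2]⟩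
  have hminus : ∀ u ∈ Ioo (-η) η, p - u ∈ Ioo (p - η) (p + η) := fun u hu =>
    ⟨by linarith [hu.2], by linarith [hu.1]⟩
  have dplus : ∀ (L : ℝ × ℝ →L[ℝ] ℝ) (n : ℕ), ∀ u ∈ Ioo (-η) η,
      HasDerivAt (fun u => L (iteratedDeriv n c (p + u))) (L (iteratedDeriv (n + 1) c (p + u))) u :=
    fun L n u hu => L.hasFDerivAt.comp_hasDerivAt u
      ((hasDerivAt_iteratedDeriv_s2 (hc _ (hplus u hu)) n).comp_const_add p u)
  have dminus : ∀ (L : ℝ × ℝ →L[ℝ] ℝ) (n : ℕ), ∀ u ∈ Ioo (-η) η,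
      HasDerivAt (fun u => L (iteratedDeriv n c (p - u)))
        (-L (iteratedDeriv (n + 1) c (p - u))) u :=
    fun L n u hu => by
      have := L.hasFDerivAt.comp_hasDerivAt u
        ((hasDerivAt_iteratedDeriv_s2 (hc _ (hminus u hu)) n).comp_const_sub p u)
      rwa [map_neg] at this
  have hode : ∀ L : ℝ × ℝ →L[ℝ] ℝ, ∀ u ∈ Ioo (-η) η,
      L (iteratedDeriv 3 c (p + u)) = -r * L (iteratedDeriv 1 c (p + u)) ∧
      L (iteratedDeriv 3 c (p - u)) = -r * L (iteratedDeriv 1 c (p - u)) := fun L u hu => by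
    rw [hr _ (hplus u hu), hr _ (hminus u hu), map_smul, map_smul, smul_eq_mul, smul_eq_mul]
    exact ⟨rfl, rfl⟩
  constructor
  · set L := det2L (iteratedDeriv 1 c p) with hL
    have := eq_zero_of_third_order_ode (r := r) (η := η)
      (f := fun u => L (iteratedDeriv 0 c (p + u)) - L (iteratedDeriv 0 c (p - u)))
      (f₁ := fun u => L (iteratedDeriv 1 c (p + u)) + L (iteratedDeriv 1 c (p - u)))
      (f₂ := fun u => L (iteratedDeriv 2 c (p + u)) - L (iteratedDeriv 2 c (p - u)))
      (fun u hu => ((dplus L 0 u hu).sub (dminus L 0 u hu)).congr_deriv (by ring))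
      (fun u hu => ((dplus L 1 u hu).add (dminus L 1 u hu)).congr_deriv (by ring))
      (fun u hu => by
        refine ((dplus L 2 u hu).sub (dminus L 2 u hu)).congr_deriv ?_
        linear_combination (hode L u hu).1 + (hode L u hu).2)
      (by simp) (by simp [hL, det2L_self]) (by simp) u hu
    simp only [iteratedDeriv_zero] at this
    rw [map_sub, map_sub]
    linarith
  · set L := det2L (iteratedDeriv 2 c p) with hL
    have := eq_zero_of_third_order_ode (r := r) (η := η)
      (f := fun u => L (iteratedDeriv 0 c (p + u)) + L (iteratedDeriv 0 c (p - u)) - 2 * L (c p))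
      (f₁ := fun u => L (iteratedDeriv 1 c (p + u)) - L (iteratedDeriv 1 c (p - u)))
      (f₂ := fun u => L (iteratedDeriv 2 c (p + u)) + L (iteratedDeriv 2 c (p - u)))
      (fun u hu =>
        (((dplus L 0 u hu).add (dminus L 0 u hu)).sub_const (2 * L (c p))).congr_deriv (by ring))
      (fun u hu => ((dplus L 1 u hu).sub (dminus L 1 u hu)).congr_deriv (by ring))
      (fun u hu => by
        refine ((dplus L 2 u hu).add (dminus L 2 u hu)).congr_deriv ?_
        linear_combination (hode L u hu).1 - (hode L u hu).2)
      (by simp; ring) (by simp) (by simp [hL, det2L_self]) u hu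
    simp only [iteratedDeriv_zero] at this
    rw [map_add, map_sub, map_sub]
    linarith

/-- Constant affine curvature forces the gravity curves to be straight. -/
theorem isStraightLine_of_const_curvature {c : ℝ → ℝ × ℝ} {I : Set ℝ}
    (hc : AnalyticOnNhd ℝ c I) {p r ε : ℝ} {γ : ℝ → ℝ × ℝ}
    (hdet : det2 (iteratedDeriv 1 c p) (iteratedDeriv 2 c p) = 1)
    (hr : ∀ s ∈ I, iteratedDeriv 3 c s = -r • iteratedDeriv 1 c s)
    (hγ : IsGravityCurve c I p ε γ) : IsStraightLine γ ε := by
  obtain ⟨hε, hγ0, J, hJI, hJo, hpJ, sm, sp, h⟩ := hγ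
  obtain ⟨η, hη, hsub, hcont, hanti, hmono⟩ :=
    exists_height_valley (hc p (hJI hpJ)) hdet (hJo.mem_nhds hpJ)
  have htop : 0 < det2L (iteratedDeriv 1 c p) (c (p + η) - c p) := by
    simpa using hmono ⟨le_rfl, by linarith⟩ ⟨by linarith, le_rfl⟩ (by linarith : p < p + η)
  refine ⟨_, lt_min hε htop, min_le_left _ _, c p, iteratedDeriv 2 c p, ?_, fun δ hδ => ⟨δ, ?_⟩⟩
  · intro h0
    simp [h0, det2] at hdet
  rcases hδ.1.eq_or_lt with rfl | hδ0
  · simp [hγ0]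
  have hδε : δ ∈ Ioo 0 ε := ⟨hδ0, hδ.2.trans_le (min_le_left _ _)⟩
  obtain ⟨hmJ, hpJ', hmp, hpp, hiff, hγδ⟩ := h δ hδε
  obtain ⟨s, hs, hsδ⟩ := intermediate_value_Ioo (by linarith)
    (hcont.mono (Icc_subset_Icc_left (by linarith : p - η ≤ p)))
    (show δ ∈ Ioo _ _ from ⟨by simpa using hδ0, hδ.2.trans_le (min_le_right _ _)⟩)
  beta_reduce at hsδ
  obtain ⟨hsym, hzero⟩ := reflection_symmetry (p := p) (η := η) (u := s - p)
    (fun t ht => hc t (hJI (hsub (Ioo_subset_Icc_self ht))))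
    (fun t ht => hr t (hJI (hsub (Ioo_subset_Icc_self ht))))
    ⟨by linarith [hs.1], by linarith [hs.2]⟩
  rw [add_sub_cancel] at hsym hzero
  have hspos : s = sp δ := by
    have := (hiff s (hsub ⟨by linarith [hs.1], hs.2.le⟩)).1 ((det2_line_eq_zero_iff hdet).2 hsδ)
    rcases this with h | h
    · linarith [hs.1]
    · exact h
  have hsneg : p - (s - p) = sm δ := by
    have := (hiff (p - (s - p)) (hsub ⟨by linarith [hs.2], by linarith [hs.1]⟩)).1
      ((det2_line_eq_zero_iff hdet).2 (hsym.symm.trans hsδ))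
    rcases this with h | h
    · exact h
    · linarith [hs.1]
  rw [hsneg] at hzero hsym
  rw [hspos] at hzero hsym hsδ
  rw [hγδ]
  rw [hsδ] at hsym
  rw [det2L_apply] at hzero hsym hsδ
  rw [det2] at hdet
  simp only [Prod.fst_sub, Prod.snd_sub, Prod.fst_add, Prod.snd_add] at hzero hsym hsδ
  ext
  · simp only [Prod.smul_fst, Prod.fst_add, smul_eq_mul]
    generalize iteratedDeriv 1 c p = e at *
    generalize iteratedDeriv 2 c p = f at *
    linear_combination (-(1 / 2 : ℝ) * ((c (sp δ)).1 - (c p).1 + ((c (sm δ)).1 - (c p).1))) * hdet +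
      f.1 / 2 * (hsδ - hsym) - e.1 / 2 * hzero
  · simp only [Prod.smul_snd, Prod.snd_add, smul_eq_mul]
    generalize iteratedDeriv 1 c p = e at *
    generalize iteratedDeriv 2 c p = f at *
    linear_combination (-(1 / 2 : ℝ) * ((c (sp δ)).2 - (c p).2 + ((c (sm δ)).2 - (c p).2))) * hdet +
      f.2 / 2 * (hsδ - hsym) - e.2 / 2 * hzero

/-- The higher derivatives of the curve in terms of the affine curvature. -/
theorem hasDerivAt_curvature {c : ℝ → ℝ × ℝ} {I : Set ℝ} (hIo : IsOpen I)
    (hc : AnalyticOnNhd ℝ c I)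
    (hdet : ∀ s ∈ I, det2 (iteratedDeriv 1 c s) (iteratedDeriv 2 c s) = 1) {κ : ℝ → ℝ}
    (hκ : ∀ s ∈ I, iteratedDeriv 3 c s = -κ s • iteratedDeriv 1 c s) {p : ℝ} (hp : p ∈ I) :
    AnalyticAt ℝ κ p ∧
      iteratedDeriv 4 c p = -κ p • iteratedDeriv 2 c p - deriv κ p • iteratedDeriv 1 c p ∧
      iteratedDeriv 5 c p = -κ p • iteratedDeriv 3 c p - (2 * deriv κ p) • iteratedDeriv 2 c p -
        deriv (deriv κ) p • iteratedDeriv 1 c p := by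
  have han : ∀ s ∈ I, AnalyticAt ℝ κ s := by
    intro s hs
    have hA : ∀ n, AnalyticAt ℝ (iteratedDeriv n c) s := fun n => by
      rw [iteratedDeriv_eq_iterate]
      exact (hc s hs).iterated_deriv n
    have hA1 : ∀ n, AnalyticAt ℝ (fun t => (iteratedDeriv n c t).1) s := fun n =>
      analyticAt_fst.comp (hA n)
    have hA2 : ∀ n, AnalyticAt ℝ (fun t => (iteratedDeriv n c t).2) s := fun n =>
      analyticAt_snd.comp (hA n)
    refine (((hA1 2).mul (hA2 3)).sub ((hA2 2).mul (hA1 3))).congr ?_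
    filter_upwards [hIo.mem_nhds hs] with t ht
    have h1 := hdet t ht
    have h2 := hκ t ht
    rw [det2] at h1
    simp only [Pi.sub_apply, Pi.mul_apply, h2, Prod.smul_fst, Prod.smul_snd, smul_eq_mul]
    linear_combination κ t * h1
  have h4 : ∀ s ∈ I, iteratedDeriv 4 c s =
      -κ s • iteratedDeriv 2 c s - deriv κ s • iteratedDeriv 1 c s := by
    intro s hs
    have hd := ((han s hs).differentiableAt.hasDerivAt.neg).smul
      (hasDerivAt_iteratedDeriv_s2 (hc s hs) 1)
    have hev : iteratedDeriv 3 c =ᶠ[𝓝 s] (-κ) • iteratedDeriv 1 c := by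
      filter_upwards [hIo.mem_nhds hs] with t ht using hκ t ht
    rw [(hasDerivAt_iteratedDeriv_s2 (hc s hs) 3).unique (hd.congr_of_eventuallyEq hev)]
    simp [sub_eq_add_neg]
  refine ⟨han p hp, h4 p hp, ?_⟩
  have hd := (((han p hp).differentiableAt.hasDerivAt.neg).smul
      (hasDerivAt_iteratedDeriv_s2 (hc p hp) 2)).sub
    (((han p hp).deriv.differentiableAt.hasDerivAt).smul (hasDerivAt_iteratedDeriv_s2 (hc p hp) 1))
  have hev : iteratedDeriv 4 c =ᶠ[𝓝 p]
      (-κ) • iteratedDeriv 2 c - deriv κ • iteratedDeriv 1 c := by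
    filter_upwards [hIo.mem_nhds hp] with t ht using h4 t ht
  rw [(hasDerivAt_iteratedDeriv_s2 (hc p hp) 4).unique (hd.congr_of_eventuallyEq hev)]
  simp only [Pi.neg_apply]
  module

/-- A straight gravity curve at `p` forces the affine curvature to be stationary at `p`. -/
theorem deriv_curvature_eq_zero {c : ℝ → ℝ × ℝ} {I : Set ℝ} (hIo : IsOpen I)
    (hIc : I.OrdConnected) (hc : AnalyticOnNhd ℝ c I)
    (hdet : ∀ s ∈ I, det2 (iteratedDeriv 1 c s) (iteratedDeriv 2 c s) = 1) {κ : ℝ → ℝ}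
    (hκ : ∀ s ∈ I, iteratedDeriv 3 c s = -κ s • iteratedDeriv 1 c s) {p : ℝ} (hp : p ∈ I)
    (hline : ∀ ε : ℝ, ∀ γ : ℝ → ℝ × ℝ, IsGravityCurve c I p ε γ → IsStraightLine γ ε) :
    deriv κ p = 0 := by
  obtain ⟨ε, hε, sm, sp, γ, hγ, hbr, htm, htp⟩ := exists_isGravityCurve hIo hc hp (hdet p hp)
  obtain ⟨ε₀, hε₀, hle, x, v, hv, hxv⟩ := hline ε γ hγ
  obtain ⟨-, h4, h5⟩ := hasDerivAt_curvature hIo hc hdet hκ hp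
  have h3 := hκ p hp
  rw [h3] at h5
  have hD : det2L (iteratedDeriv 1 c p) (iteratedDeriv 2 c p) = 1 := by
    rw [det2L_apply]; exact hdet p hp
  have hD' : det2L (iteratedDeriv 2 c p) (iteratedDeriv 1 c p) = -1 := by
    rw [← hD, det2L_apply, det2L_apply]; ring
  have hTx := tendsto_taylor_coord hIo hIc hc hp (det2L (iteratedDeriv 2 c p)) 4
  have hTy := tendsto_taylor_coord hIo hIc hc hp (det2L (iteratedDeriv 1 c p)) 5
  simp only [Finset.sum_range_succ, Finset.sum_range_zero, h3, h4, h5, map_sub, map_smul,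
    smul_eq_mul, det2L_self, hD, hD', iteratedDeriv_zero, Nat.factorial] at hTx hTy
  obtain ⟨t₀, ht₀⟩ := hxv 0 ⟨le_rfl, hε₀⟩
  rw [hγ.2.1] at ht₀
  refine coeff_eq_zero_of_midpoint_collinear (l := 𝓝[>] (0 : ℝ)) (k := κ p) (k₁ := deriv κ p)
    (a := -(det2L (iteratedDeriv 2 c p) v / det2L (iteratedDeriv 1 c p) v))
    (x := fun u => -det2L (iteratedDeriv 2 c p) (c (p + u) - c p))
    (y := fun u => det2L (iteratedDeriv 1 c p) (c (p + u) - c p))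
    (P := fun δ => sp δ - p) (M := fun δ => p - sm δ) ?_ ?_ ?_ ?_ ?_ ?_
  · have := (hTx.neg).add_const (-deriv κ p / 24)
    rw [neg_zero, zero_add] at this
    refine this.congr' ?_
    filter_upwards [self_mem_nhdsWithin] with u hu
    have hu : u ≠ 0 := hu
    rw [map_sub]
    push_cast
    field_simp
    ring
  · have := hTy.add_const (-deriv κ p / 60)
    rw [zero_add] at this
    refine this.congr' ?_
    filter_upwards [self_mem_nhdsWithin] with u hu
    have hu : u ≠ 0 := hu
    rw [map_sub]
    push_cast
    field_simp
    ring
  · refine tendsto_nhdsWithin_iff.2 ⟨by simpa using htp.sub_const p, ?_⟩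
    filter_upwards [Ioo_mem_nhdsGT hε] with δ hδ
    exact sub_pos.2 (hbr δ hδ).2.1
  · refine tendsto_nhdsWithin_iff.2 ⟨by simpa using htm.const_sub p, ?_⟩
    filter_upwards [Ioo_mem_nhdsGT hε] with δ hδ
    exact sub_pos.2 (hbr δ hδ).1
  · filter_upwards [Ioo_mem_nhdsGT hε] with δ hδ
    rw [add_sub_cancel, neg_sub, add_sub_cancel, (hbr δ hδ).2.2.1, (hbr δ hδ).2.2.2.1]
  · filter_upwards [Ioo_mem_nhdsGT hε₀] with δ hδ
    obtain ⟨-, -, hym, hyp, hγδ⟩ := hbr δ ⟨hδ.1, hδ.2.trans_le hle⟩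
    rw [add_sub_cancel, neg_sub, add_sub_cancel, hyp]
    obtain ⟨t, ht⟩ := hxv δ ⟨hδ.1.le, hδ.2⟩
    have hmid : (c (sp δ) - c p) + (c (sm δ) - c p) = (2 * (t - t₀)) • v := by
      have h1 : c (sm δ) + c (sp δ) = (2 : ℝ) • (x + t • v) := by
        rw [← ht, hγδ, smul_smul]; norm_num
      calc (c (sp δ) - c p) + (c (sm δ) - c p) = c (sm δ) + c (sp δ) - (2 : ℝ) • c p := by module
        _ = (2 * (t - t₀)) • v := by rw [h1, ht₀]; module
    have hy := congrArg (det2L (iteratedDeriv 1 c p)) hmid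
    have hx := congrArg (det2L (iteratedDeriv 2 c p)) hmid
    rw [map_add, map_smul, smul_eq_mul] at hy hx
    rw [hym, hyp] at hy
    have hδ0 : δ ≠ 0 := hδ.1.ne'
    have hne : det2L (iteratedDeriv 1 c p) v ≠ 0 := by
      intro h0
      rw [h0, mul_zero] at hy
      exact hδ0 (by linarith)
    field_simp
    have hyt : δ = (t - t₀) * det2L (iteratedDeriv 1 c p) v := by linarith
    linear_combination -det2L (iteratedDeriv 1 c p) v * hx +
      2 * det2L (iteratedDeriv 2 c p) v * hyt

/-- for a real-analytic non-degenerate plane curve `c` parametrized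
by affine arclength with affine curvature `κ`, the gravity curve of `c` at `p` is
a straight line for every `p ∈ I` if and only if `κ` is constant on `I`. -/
theorem stmt2 (I : Set ℝ) (hIo : IsOpen I) (hIc : I.OrdConnected)
    (c : ℝ → ℝ × ℝ) (hc : AnalyticOnNhd ℝ c I)
    (hdet : ∀ s ∈ I, det2 (iteratedDeriv 1 c s) (iteratedDeriv 2 c s) = 1)
    (κ : ℝ → ℝ)
    (hκ : ∀ s ∈ I, iteratedDeriv 3 c s = -κ s • iteratedDeriv 1 c s) :
    (∀ p ∈ I, ∀ ε : ℝ, ∀ γ : ℝ → ℝ × ℝ,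
        IsGravityCurve c I p ε γ → IsStraightLine γ ε) ↔
      ∃ r : ℝ, ∀ s ∈ I, κ s = r := by
  constructor
  · intro h
    exact hIo.exists_is_const_of_deriv_eq_zero hIc.isPreconnected
      (fun s hs =>
        (hasDerivAt_curvature hIo hc hdet hκ hs).1.differentiableAt.differentiableWithinAt)
      (fun p hp => deriv_curvature_eq_zero hIo hIc hc hdet hκ hp (h p hp))
  · rintro ⟨r, hr⟩ p hp ε γ hγ
    exact isStraightLine_of_const_curvature hc (hdet p hp)
      (fun s hs => by rw [hκ s hs, hr s hs]) hγ

end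
end

section
/- Let c : I → ℝ² be a smooth non-degenerate plane curve parametrized by affine arclength, with affine curvature κ. Fix p ∈ I and suppose c is real-analytic and normalized so that c(p) = 0, c'(p) = (1,0), c''(p) = (0,1); write c(p+s) = (f(s), g(s)) for s near 0. Then there is a real-analytic function u on a neighborhood of 0 with u(s)² = g(s) and u'(0) = 1/√2; let v be the local inverse of u at 0 and set h := f ∘ v. Then h(t) = √2·t − (κ(p)/(2√2))·t³ − (κ'(p)/10)·t⁴ − ((8κ''(p) + 15κ(p)²)/(240√2))·t⁵ − ((κ'''(p) + 9κ(p)κ'(p))/210)·t⁶ + O(t⁷) as t → 0. -/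
open Set Filter Asymptotics

noncomputable section

theorem isBigO_of_isBigO_mul_left {l : Filter ℝ} {a φ ψ : ℝ → ℝ}
    (h : (fun s => a s * φ s) =O[l] fun s => a s * ψ s) (ha : ∀ᶠ s in l, a s ≠ 0) :
    φ =O[l] ψ := by
  obtain ⟨C, hC⟩ := h.bound
  refine IsBigO.of_bound C ?_
  filter_upwards [hC, ha] with s hs hs0
  rw [norm_mul, norm_mul, mul_left_comm] at hs
  exact le_of_mul_le_mul_left hs (norm_pos_iff.2 hs0)

theorem AnalyticAt.isBigO_sub_taylor {y : ℝ → ℝ} (hy : AnalyticAt ℝ y 0) (n : ℕ) :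
    (fun s : ℝ => y s - ∑ i ∈ Finset.range n, iteratedDeriv i y 0 / i.factorial * s ^ i)
      =O[nhds 0] fun s : ℝ => s ^ n := by
  have h := hy.hasFPowerSeriesAt.isBigO_sub_partialSum_pow n
  simpa only [zero_add, FormalMultilinearSeries.partialSum,
    FormalMultilinearSeries.ofScalars_apply_eq, smul_eq_mul, ← norm_pow,
    isBigO_norm_right] using h

theorem iteratedDeriv_add_three_of_eventuallyEq {y k : ℝ → ℝ} {x : ℝ}
    (hy : AnalyticAt ℝ y x) (hk : AnalyticAt ℝ k x)
    (h : ∀ᶠ s in nhds x, iteratedDeriv 3 y s = -(k s * deriv y s)) (n : ℕ) :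
    iteratedDeriv (n + 3) y x = -∑ i ∈ Finset.range (n + 1),
      n.choose i * iteratedDeriv i k x * iteratedDeriv (n - i + 1) y x := by
  have h1 : iteratedDeriv (n + 3) y = iteratedDeriv n (iteratedDeriv 3 y) := by
    simp only [iteratedDeriv_eq_iterate, Function.iterate_add_apply]
  have h2 : iteratedDeriv 3 y =ᶠ[nhds x] fun s => -(k * deriv y) s := h
  rw [h1, h2.iteratedDeriv_eq n, iteratedDeriv_fun_neg,
    iteratedDeriv_mul hk.contDiffAt hy.deriv.contDiffAt]
  simp only [iteratedDeriv_succ']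

theorem exists_analyticAt_sq_eq {g : ℝ → ℝ} (hg : AnalyticAt ℝ g 0) (h0 : g 0 = 0)
    (h1 : iteratedDeriv 1 g 0 = 0) (h2 : iteratedDeriv 2 g 0 = 1) :
    ∃ u : ℝ → ℝ, AnalyticAt ℝ u 0 ∧ (∀ᶠ s in nhds 0, u s ^ 2 = g s) ∧ u 0 = 0 ∧
      deriv u 0 = 1 / √2 := by
  have hord : ((2 : ℕ) : ℕ∞) ≤ analyticOrderAt g 0 := by
    rw [natCast_le_analyticOrderAt_iff_iteratedDeriv_eq_zero hg]
    intro i hi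
    interval_cases i
    · simpa using h0
    · exact h1
  obtain ⟨G, hG, hgG⟩ := (natCast_le_analyticOrderAt hg).1 hord
  simp only [sub_zero, smul_eq_mul] at hgG
  have hG0 : G 0 = 1 / 2 := by
    have h3 := hg.isBigO_sub_taylor 3
    have h4 : (fun s : ℝ => s ^ 2 * (G s - 1 / 2)) =O[nhds 0] fun s : ℝ => s ^ 2 * s := by
      refine h3.congr' ?_ (.of_forall fun s => by ring)
      filter_upwards [hgG] with s hs
      simp [Finset.sum_range_succ, h0, h1, h2, hs, Nat.factorial]
      ring
    have h5 : (fun s : ℝ => G s - 1 / 2) =O[nhdsWithin (0 : ℝ) {0}ᶜ] fun s : ℝ => s :=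
      isBigO_of_isBigO_mul_left (h4.mono nhdsWithin_le_nhds)
        (eventually_mem_nhdsWithin.mono fun s hs => pow_ne_zero 2 hs)
    have h6 : Tendsto (fun s : ℝ => G s - 1 / 2) (nhdsWithin (0 : ℝ) {0}ᶜ) (nhds 0) :=
      h5.trans_tendsto (tendsto_nhdsWithin_of_tendsto_nhds tendsto_id)
    have h7 : Tendsto (fun s : ℝ => G s - 1 / 2) (nhdsWithin (0 : ℝ) {0}ᶜ) (nhds (G 0 - 1 / 2)) :=
      (hG.continuousAt.tendsto.sub_const _).mono_left nhdsWithin_le_nhds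
    linarith [tendsto_nhds_unique h6 h7]
  have hsqrt : AnalyticAt ℝ (fun s => √(G s)) 0 :=
    (Real.contDiffAt_sqrt (by rw [hG0]; norm_num)).analyticAt.fun_comp hG
  refine ⟨fun s => s * √(G s), by fun_prop, ?_, by simp, ?_⟩
  · have : ∀ᶠ s in nhds 0, 0 < G s :=
      hG.continuousAt.eventually (lt_mem_nhds (by rw [hG0]; norm_num))
    filter_upwards [hgG, this] with s hs hpos
    rw [hs, mul_pow, Real.sq_sqrt hpos.le]
  · have := (hasDerivAt_id' (0 : ℝ)).fun_mul hsqrt.differentiableAt.hasDerivAt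
    simpa [hG0] using this.deriv

/-- Two square roots with the same nonzero derivative agree to one order less than their squares. -/
theorem isBigO_sub_of_isBigO_sq_sub_sq {u w : ℝ → ℝ} {a : ℝ} (ha : a ≠ 0)
    (hu : HasDerivAt u a 0) (hw : HasDerivAt w a 0) (hu0 : u 0 = 0) (hw0 : w 0 = 0) {n : ℕ}
    (h : (fun s => u s ^ 2 - w s ^ 2) =O[nhds 0] fun s : ℝ => s ^ (n + 1)) :
    (fun s => u s - w s) =O[nhds 0] fun s : ℝ => s ^ n := by
  have hsum : (fun s : ℝ => s) =O[nhds 0] fun s => u s + w s := by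
    have h1 := ((hu.fun_add hw).isTheta_sub (by simpa using ha)).isBigO_symm
    have h2 : Tendsto (fun s : ℝ => (s, (0 : ℝ))) (nhds 0) (nhds 0 ×ˢ pure 0) :=
      tendsto_id.prodMk (tendsto_pure.2 (.of_forall fun _ => rfl))
    simpa [Function.comp_def, hu0, hw0] using h1.comp_tendsto h2
  have hmul : (fun s => s * (u s - w s)) =O[nhds 0] fun s : ℝ => s * s ^ n :=
    ((hsum.mul (isBigO_refl (fun s => u s - w s) (nhds 0))).trans
      (h.congr_left fun s => by ring)).congr_right fun s => by ring
  rw [← nhdsNE_sup_pure, isBigO_sup]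
  refine ⟨isBigO_of_isBigO_mul_left (hmul.mono nhdsWithin_le_nhds)
    (eventually_mem_nhdsWithin.mono fun s hs => hs), ?_⟩
  exact isBigO_pure.2 fun _ => by simp [hu0, hw0]

theorem isBigO_pow_mul_of_continuous {Q : ℝ → ℝ} (hQ : Continuous Q) (n : ℕ) :
    (fun s : ℝ => s ^ n * Q s) =O[nhds 0] fun s : ℝ => s ^ n := by
  simpa using (isBigO_refl (fun s : ℝ => s ^ n) (nhds 0)).mul
    ((hQ.tendsto 0).isBigO_one ℝ)

theorem AnalyticAt.exists_analyticAt_inverse {u : ℝ → ℝ} (hu : AnalyticAt ℝ u 0) (hu0 : u 0 = 0)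
    (hu' : deriv u 0 ≠ 0) :
    ∃ v : ℝ → ℝ, AnalyticAt ℝ v 0 ∧ v 0 = 0 ∧ (∀ᶠ s in nhds 0, v (u s) = s) ∧
      ∀ᶠ t in nhds 0, u (v t) = t := by
  have hl := hu.hasStrictDerivAt.eventually_left_inverse hu'
  have hr := hu.hasStrictDerivAt.eventually_right_inverse hu'
  have hv := hu.analyticAt_localInverse hu'
  rw [hu0] at hr hv
  refine ⟨_, hv, ?_, hl, hr⟩
  simpa only [hu0] using hl.self_of_nhds

theorem iteratedDeriv_continuousLinearMap_comp_const_add {E F : Type*}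
    [NormedAddCommGroup E] [NormedSpace ℝ E] [NormedAddCommGroup F] [NormedSpace ℝ F]
    (L : E →L[ℝ] F) {c : ℝ → E} {p s : ℝ} (n : ℕ)
    (hc : ContDiffAt ℝ n c (p + s)) :
    iteratedDeriv n (fun s => L (c (p + s))) s = L (iteratedDeriv n c (p + s)) := by
  rw [iteratedDeriv_comp_const_add n (fun s => L (c s)) p]
  change iteratedDeriv n (L ∘ c) (p + s) = _
  rw [iteratedDeriv_eq_iteratedFDeriv, L.iteratedFDeriv_comp_left hc le_rfl,
    iteratedDeriv_eq_iteratedFDeriv]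
  rfl

/-- The Taylor polynomial of degree `6` of `√(2 g)`, where the third derivative of `g` is `-k`
times its first one and `g` vanishes to order two at `0` with second derivative `1`, in terms of
the derivatives `k₀, …, k₃` of `k` at `0`. -/
def sqrtTaylor (k₀ k₁ k₂ k₃ s : ℝ) : ℝ :=
  s - k₀ / 24 * s ^ 3 - k₁ / 60 * s ^ 4 + (k₀ ^ 2 / 1920 - k₂ / 240) * s ^ 5
    + (k₀ * k₁ / 2016 - k₃ / 1260) * s ^ 6

/-- The Taylor polynomial of degree `6` of the first coordinate as a function of the square root
of the second one. -/
def graphTaylor (k₀ k₁ k₂ k₃ t : ℝ) : ℝ :=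
  √2 * t - k₀ / (2 * √2) * t ^ 3 - k₁ / 10 * t ^ 4
    - (8 * k₂ + 15 * k₀ ^ 2) / (240 * √2) * t ^ 5 - (k₃ + 9 * k₀ * k₁) / 210 * t ^ 6

theorem hasDerivAt_sqrtTaylor_zero (k₀ k₁ k₂ k₃ : ℝ) :
    HasDerivAt (sqrtTaylor k₀ k₁ k₂ k₃) 1 0 := by
  have h : Differentiable ℝ fun s : ℝ => 1 - k₀ / 24 * s ^ 2 - k₁ / 60 * s ^ 3
      + (k₀ ^ 2 / 1920 - k₂ / 240) * s ^ 4 + (k₀ * k₁ / 2016 - k₃ / 1260) * s ^ 5 := by fun_prop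
  have h' := ((hasDerivAt_id' (0 : ℝ)).fun_mul (h 0).hasDerivAt).congr_deriv (g' := 1) (by simp)
  refine h'.congr_of_eventuallyEq (.of_forall fun s => ?_)
  rw [sqrtTaylor]
  ring

theorem graphTaylor_div_sqrt_two (k₀ k₁ k₂ k₃ w : ℝ) :
    graphTaylor k₀ k₁ k₂ k₃ (w / √2) =
      w - k₀ / 8 * w ^ 3 - k₁ / 40 * w ^ 4 - (8 * k₂ + 15 * k₀ ^ 2) / 1920 * w ^ 5
        - (k₃ + 9 * k₀ * k₁) / 1680 * w ^ 6 := by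
  have h2 : √2 ^ 2 = 2 := Real.sq_sqrt (by norm_num)
  have h4 : √2 ^ 4 = 4 := by rw [show √2 ^ 4 = (√2 ^ 2) ^ 2 by ring, h2]; norm_num
  have h6 : √2 ^ 6 = 8 := by rw [show √2 ^ 6 = (√2 ^ 2) ^ 3 by ring, h2]; norm_num
  have hi : ∀ x : ℝ, x / √2 = x * √2 / 2 := fun x => by
    field_simp
    rw [h2]
  have hi2 : ∀ x y : ℝ, x / (y * √2) = x / y * √2 / 2 := fun x y => by rw [← div_div, hi]
  rw [graphTaylor, hi, hi2, hi2]
  linear_combination w / 2 * h2 - (k₀ / 32 * w ^ 3 + k₁ / 160 * w ^ 4) * h4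
    - ((8 * k₂ + 15 * k₀ ^ 2) / 15360 * w ^ 5 + (k₃ + 9 * k₀ * k₁) / 13440 * w ^ 6) * h6

theorem isBigO_sub_sqrtTaylor_sq {g k : ℝ → ℝ} (hg : AnalyticAt ℝ g 0) (hk : AnalyticAt ℝ k 0)
    (h : ∀ᶠ s in nhds 0, iteratedDeriv 3 g s = -(k s * deriv g s))
    (h0 : g 0 = 0) (h1 : deriv g 0 = 0) (h2 : iteratedDeriv 2 g 0 = 1) {a b c d : ℝ}
    (ha : k 0 = a) (hb : deriv k 0 = b) (hc : iteratedDeriv 2 k 0 = c)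
    (hd : iteratedDeriv 3 k 0 = d) :
    (fun s => g s - (sqrtTaylor a b c d s / √2) ^ 2) =O[nhds 0] fun s : ℝ => s ^ 8 := by
  have hrec := iteratedDeriv_add_three_of_eventuallyEq hg hk h
  have h3 := hrec 0
  have h4 := hrec 1
  have h5 := hrec 2
  have h6 := hrec 3
  have h7 := hrec 4
  simp only [Finset.sum_range_succ, Finset.sum_range_zero, iteratedDeriv_zero] at h3 h4 h5 h6 h7
  norm_num [h1, h2, ha, hb, hc, hd, Nat.choose] at h3 h4 h5 h6 h7
  norm_num [h3] at h5
  norm_num [h3, h4] at h6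
  norm_num [h3, h4, h5] at h7
  have ht := hg.isBigO_sub_taylor 8
  simp only [Finset.sum_range_succ, Finset.sum_range_zero, iteratedDeriv_zero, iteratedDeriv_one,
    h0, h1, h2, h3, h4, h5, h6, h7, Nat.factorial] at ht
  have hQ : Continuous fun s : ℝ =>
      let e₀ := -a / 24
      let e₁ := -b / 60
      let e₂ := a ^ 2 / 1920 - c / 240 + (a * b / 2016 - d / 1260) * s;
      -((e₁ ^ 2 + 2 * (e₀ + e₁ * s) * e₂ + s ^ 2 * e₂ ^ 2) / 2) := by fun_prop
  refine (ht.add (isBigO_pow_mul_of_continuous hQ 8)).congr_left fun s => ?_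
  rw [div_pow, Real.sq_sqrt zero_le_two, sqrtTaylor]
  push_cast
  ring

theorem isBigO_sub_graphTaylor_sqrtTaylor {f k : ℝ → ℝ} (hf : AnalyticAt ℝ f 0)
    (hk : AnalyticAt ℝ k 0) (h : ∀ᶠ s in nhds 0, iteratedDeriv 3 f s = -(k s * deriv f s))
    (h0 : f 0 = 0) (h1 : deriv f 0 = 1) (h2 : iteratedDeriv 2 f 0 = 0) {a b c d : ℝ}
    (ha : k 0 = a) (hb : deriv k 0 = b) (hc : iteratedDeriv 2 k 0 = c)
    (hd : iteratedDeriv 3 k 0 = d) :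
    (fun s => f s - graphTaylor a b c d (sqrtTaylor a b c d s / √2))
      =O[nhds 0] fun s : ℝ => s ^ 7 := by
  have hrec := iteratedDeriv_add_three_of_eventuallyEq hf hk h
  have h3 := hrec 0
  have h4 := hrec 1
  have h5 := hrec 2
  have h6 := hrec 3
  simp only [Finset.sum_range_succ, Finset.sum_range_zero, iteratedDeriv_zero] at h3 h4 h5 h6
  norm_num [h1, h2, ha, hb, hc, hd, Nat.choose] at h3 h4 h5 h6
  norm_num [h3] at h5
  norm_num [h3, h4] at h6
  have ht := hf.isBigO_sub_taylor 7
  simp only [Finset.sum_range_succ, Finset.sum_range_zero, iteratedDeriv_zero, iteratedDeriv_one,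
    h0, h1, h2, h3, h4, h5, h6, Nat.factorial] at ht
  simp only [graphTaylor_div_sqrt_two]
  have hQ : Continuous fun s : ℝ =>
      let e₀ := -a / 24
      let e₁ := -b / 60
      let e₂ := a ^ 2 / 1920 - c / 240 + (a * b / 2016 - d / 1260) * s
      let e := e₀ + e₁ * s + e₂ * s ^ 2
      a / 8 * (3 * e₂ + 3 * e ^ 2 + s ^ 2 * e ^ 3)
        + b / 40 * (4 * (e₁ + s * e₂) + 6 * s * e ^ 2 + 4 * s ^ 3 * e ^ 3 + s ^ 5 * e ^ 4)
        + (8 * c + 15 * a ^ 2) / 1920 * (5 * e + 10 * s ^ 2 * e ^ 2 + 10 * s ^ 4 * e ^ 3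
          + 5 * s ^ 6 * e ^ 4 + s ^ 8 * e ^ 5)
        + (d + 9 * a * b) / 1680 * s * (6 * e + 15 * s ^ 2 * e ^ 2 + 20 * s ^ 4 * e ^ 3
          + 15 * s ^ 6 * e ^ 4 + 6 * s ^ 8 * e ^ 5 + s ^ 10 * e ^ 6) := by fun_prop
  refine (ht.add (isBigO_pow_mul_of_continuous hQ 7)).congr_left fun s => ?_
  have hW : sqrtTaylor a b c d s = s + s ^ 3 * (-a / 24 + -b / 60 * s +
      (a ^ 2 / 1920 - c / 240 + (a * b / 2016 - d / 1260) * s) * s ^ 2) := by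
    rw [sqrtTaylor]
    ring
  rw [hW]
  push_cast
  generalize he₂ : a ^ 2 / 1920 - c / 240 + (a * b / 2016 - d / 1260) * s = e₂
  generalize he : -a / 24 + -b / 60 * s + e₂ * s ^ 2 = e
  linear_combination -(s ^ 3 - 3 * a / 8 * s ^ 5 - b / 10 * s ^ 6) * he - s ^ 5 * he₂

/-- for a real-analytic non-degenerate curve `c` parametrized by
affine arclength, normalized at `p` by `c(p) = 0`, `c'(p) = (1,0)`,
`c''(p) = (0,1)`, write `c(p+s) = (f s, g s)`.  Then there is an analytic `u`
near `0` with `u² = g` and `u'(0) = 1/√2`; with `v` the local inverse of `u` and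
`h = f ∘ v`, one has the expansion
`h(t) = √2·t − (κ(p)/(2√2))t³ − (κ'(p)/10)t⁴ − ((8κ''(p)+15κ(p)²)/(240√2))t⁵
        − ((κ'''(p)+9κ(p)κ'(p))/210)t⁶ + O(t⁷)`. -/
theorem stmt15 (I : Set ℝ) (hIo : IsOpen I) (hIc : I.OrdConnected)
    (c : ℝ → ℝ × ℝ) (hc : AnalyticOnNhd ℝ c I)
    (hdet : ∀ s ∈ I, det2 (iteratedDeriv 1 c s) (iteratedDeriv 2 c s) = 1)
    (κ : ℝ → ℝ)
    (hκ : ∀ s ∈ I, iteratedDeriv 3 c s = -κ s • iteratedDeriv 1 c s)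
    (p : ℝ) (hp : p ∈ I)
    (hc0 : c p = 0) (hc1 : iteratedDeriv 1 c p = (1, 0))
    (hc2 : iteratedDeriv 2 c p = (0, 1))
    (f g : ℝ → ℝ)
    (hf : ∀ s : ℝ, f s = (c (p + s)).1) (hg : ∀ s : ℝ, g s = (c (p + s)).2) :
    ∃ u v : ℝ → ℝ,
      AnalyticAt ℝ u 0 ∧ (∀ᶠ s in nhds 0, u s ^ 2 = g s) ∧
      deriv u 0 = 1 / Real.sqrt 2 ∧
      AnalyticAt ℝ v 0 ∧ v 0 = 0 ∧ (∀ᶠ s in nhds 0, v (u s) = s) ∧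
      (fun t : ℝ => f (v t) -
          (Real.sqrt 2 * t - κ p / (2 * Real.sqrt 2) * t ^ 3
            - deriv κ p / 10 * t ^ 4
            - (8 * iteratedDeriv 2 κ p + 15 * κ p ^ 2) / (240 * Real.sqrt 2) * t ^ 5
            - (iteratedDeriv 3 κ p + 9 * κ p * deriv κ p) / 210 * t ^ 6))
        =O[nhds (0 : ℝ)] fun t : ℝ => t ^ 7 := by
  have hcp : AnalyticAt ℝ c (p + 0) := by simpa using hc p hp
  have hadd : AnalyticAt ℝ (fun s : ℝ => p + s) 0 := by fun_prop
  have hφ : AnalyticAt ℝ (fun s => c (p + s)) 0 := hcp.fun_comp hadd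
  have hI : ∀ᶠ s in nhds (0 : ℝ), p + s ∈ I :=
    hadd.continuousAt.eventually_mem (hIo.mem_nhds (by simpa using hp))
  obtain rfl : f = fun s => ContinuousLinearMap.fst ℝ ℝ ℝ (c (p + s)) := funext hf
  obtain rfl : g = fun s => ContinuousLinearMap.snd ℝ ℝ ℝ (c (p + s)) := funext hg
  set f : ℝ → ℝ := fun s => ContinuousLinearMap.fst ℝ ℝ ℝ (c (p + s))
  set g : ℝ → ℝ := fun s => ContinuousLinearMap.snd ℝ ℝ ℝ (c (p + s))
  have hfa : AnalyticAt ℝ f 0 := analyticAt_fst.comp hφ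
  have hga : AnalyticAt ℝ g 0 := analyticAt_snd.comp hφ
  have hfd : ∀ n s, p + s ∈ I → iteratedDeriv n f s = (iteratedDeriv n c (p + s)).1 :=
    fun n s hs => iteratedDeriv_continuousLinearMap_comp_const_add _ n (hc _ hs).contDiffAt
  have hgd : ∀ n s, p + s ∈ I → iteratedDeriv n g s = (iteratedDeriv n c (p + s)).2 :=
    fun n s hs => iteratedDeriv_continuousLinearMap_comp_const_add _ n (hc _ hs).contDiffAt
  have hp0 : p + 0 ∈ I := by simpa using hp
  have hk : AnalyticAt ℝ (fun s => κ (p + s)) 0 := by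
    have hit : ∀ n, AnalyticAt ℝ (fun s => iteratedDeriv n c (p + s)) 0 := fun n => by
      rw [iteratedDeriv_eq_iterate]
      exact (hcp.iterated_deriv n).fun_comp hadd
    have hdet' : AnalyticAt ℝ (fun s => (iteratedDeriv 2 c (p + s)).1 *
        (iteratedDeriv 3 c (p + s)).2 - (iteratedDeriv 2 c (p + s)).2 *
        (iteratedDeriv 3 c (p + s)).1) 0 :=
      ((analyticAt_fst.comp (hit 2)).mul (analyticAt_snd.comp (hit 3))).sub
        ((analyticAt_snd.comp (hit 2)).mul (analyticAt_fst.comp (hit 3)))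
    refine hdet'.congr ?_
    filter_upwards [hI] with s hs
    have h1 := hdet _ hs
    rw [hκ _ hs, Prod.smul_fst, Prod.smul_snd, smul_eq_mul, smul_eq_mul]
    unfold det2 at h1
    linear_combination κ (p + s) * h1
  have hfode : ∀ᶠ s in nhds 0, iteratedDeriv 3 f s = -(κ (p + s) * deriv f s) := by
    filter_upwards [hI] with s hs
    rw [← iteratedDeriv_one, hfd _ _ hs, hfd _ _ hs, hκ _ hs]
    simp
  have hgode : ∀ᶠ s in nhds 0, iteratedDeriv 3 g s = -(κ (p + s) * deriv g s) := by
    filter_upwards [hI] with s hs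
    rw [← iteratedDeriv_one, hgd _ _ hs, hgd _ _ hs, hκ _ hs]
    simp
  have hf0 : f 0 = 0 := by simp [f, hc0]
  have hg0 : g 0 = 0 := by simp [g, hc0]
  have hf1 : deriv f 0 = 1 := by rw [← iteratedDeriv_one, hfd _ _ hp0, add_zero, hc1]
  have hg1 : deriv g 0 = 0 := by rw [← iteratedDeriv_one, hgd _ _ hp0, add_zero, hc1]
  have hf2 : iteratedDeriv 2 f 0 = 0 := by rw [hfd _ _ hp0, add_zero, hc2]
  have hg2 : iteratedDeriv 2 g 0 = 1 := by rw [hgd _ _ hp0, add_zero, hc2]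
  have hkd : ∀ n, iteratedDeriv n (fun s => κ (p + s)) 0 = iteratedDeriv n κ p := fun n => by
    simp [iteratedDeriv_comp_const_add]
  have hk0 : κ (p + 0) = κ p := by rw [add_zero]
  have hk1 : deriv (fun s => κ (p + s)) 0 = deriv κ p := by simpa using hkd 1
  have hF := isBigO_sub_graphTaylor_sqrtTaylor hfa hk hfode hf0 hf1 hf2 hk0 hk1 (hkd 2) (hkd 3)
  have hG := isBigO_sub_sqrtTaylor_sq hga hk hgode hg0 hg1 hg2 hk0 hk1 (hkd 2) (hkd 3)
  obtain ⟨u, hu, husq, hu0, hu1⟩ := exists_analyticAt_sq_eq hga hg0 (by simpa using hg1) hg2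
  have ha : 1 / √2 ≠ 0 := by positivity
  obtain ⟨v, hv, hv0, hvu, huv⟩ := hu.exists_analyticAt_inverse hu0 (hu1 ▸ ha)
  refine ⟨u, v, hu, husq, hu1, hv, hv0, hvu, ?_⟩
  generalize κ p = a, deriv κ p = b, iteratedDeriv 2 κ p = k₂, iteratedDeriv 3 κ p = k₃ at *
  have hw := (hasDerivAt_sqrtTaylor_zero a b k₂ k₃).div_const √2
  have hw0 : sqrtTaylor a b k₂ k₃ 0 / √2 = 0 := by simp [sqrtTaylor]
  have huw : (fun s => u s - sqrtTaylor a b k₂ k₃ s / √2) =O[nhds 0] fun s : ℝ => s ^ 7 :=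
    isBigO_sub_of_isBigO_sq_sub_sq ha (hu1 ▸ hu.differentiableAt.hasDerivAt) hw hu0 hw0
      (hG.congr' (husq.mono fun s hs => by simp only [hs]) .rfl)
  have hP : (fun s => graphTaylor a b k₂ k₃ (sqrtTaylor a b k₂ k₃ s / √2) -
      graphTaylor a b k₂ k₃ (u s)) =O[nhds 0] fun s : ℝ => s ^ 7 := by
    have hd : HasStrictDerivAt (graphTaylor a b k₂ k₃) _ 0 :=
      (show ContDiff ℝ 1 (graphTaylor a b k₂ k₃) by
        unfold graphTaylor; fun_prop).contDiffAt.hasStrictDerivAt one_ne_zero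
    have ht : Tendsto (fun s => (sqrtTaylor a b k₂ k₃ s / √2, u s)) (nhds 0) (nhds (0, 0)) := by
      simpa [hw0, hu0] using (hw.continuousAt.prodMk hu.continuousAt).tendsto
    exact (hd.hasStrictFDerivAt.isBigO_sub.comp_tendsto ht).trans
      (huw.neg_left.congr_left fun s => by simp)
  have hfu : (fun s => f s - graphTaylor a b k₂ k₃ (u s)) =O[nhds 0] fun s : ℝ => s ^ 7 :=
    (hF.add hP).congr_left fun s => by ring
  have hvt : Tendsto v (nhds 0) (nhds 0) := by simpa [hv0] using hv.continuousAt.tendsto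
  have hvO : v =O[nhds 0] fun t : ℝ => t := by
    simpa [hv0] using hv.differentiableAt.isBigO_sub
  refine ((hfu.comp_tendsto hvt).trans (hvO.pow 7)).congr' ?_ .rfl
  filter_upwards [huv] with t ht
  simp only [Function.comp_apply, ht, graphTaylor]

end
end
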